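/- arXiv:1811.12447 — 2 statements merged into one kernel-verified Lean document; each statement's English description precedes it below -/
import Mathlib

section
/- Fix a real γ with 0 < γ ≤ 1/70 and a real δ > 0. For each m let r_m = ⌈γ·m⌉, let R_m = 2^{-m}·binom(m, ≤ r_m), and let p_m ∈ (0, 1/2) satisfy h(p_m) = 1 - (1+δ)·R_m, where h is the binary entropy function. Let v ∈ F₂^{F₂^m} be a random error vector whose coordinates are independent Bernoulli(p_m). Then the probability that there exists a nonzero f ∈ P(m, r_m) whose evaluation vector F_f satisfies |v + F_f| ≤ |v| (Hamming weights) tends to 0 as m → ∞. (This event contains the event that maximum-likelihood decoding fails on BSC(p_m); hence RM(m, ⌈γm⌉) achieves capacity for the binary symmetric channel.) -/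
open Finset

abbrev Cube (m : ℕ) := Fin m → ZMod 2
abbrev BF (m : ℕ) := Cube m → ZMod 2

/-- Codewords of RM(m,r): functions computed by a polynomial of total degree ≤ r. -/
def RM (m r : ℕ) : Set (BF m) :=
  {f | ∃ p : MvPolynomial (Fin m) (ZMod 2), p.totalDegree ≤ r ∧
    ∀ x, MvPolynomial.eval x p = f x}

/-- Normalized weight of a Boolean function. -/
noncomputable def wt {m : ℕ} (f : BF m) : ℝ :=
  ((univ.filter fun x => f x = 1).card : ℝ) / 2 ^ m

/-- Bias of a Boolean function. -/
noncomputable def bias {m : ℕ} (f : BF m) : ℝ :=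
  (∑ x : Cube m, if f x = 0 then (1 : ℝ) else -1) / 2 ^ m

/-- Number of codewords of RM(m,r) of weight at most β. -/
noncomputable def W (m r : ℕ) (β : ℝ) : ℕ :=
  Set.ncard {f : BF m | f ∈ RM m r ∧ wt f ≤ β}

/-- binom(n, ≤ k) = ∑_{i=0}^k C(n,i). -/
def binomLe (n k : ℕ) : ℕ := ∑ i ∈ Finset.range (k + 1), n.choose i

open scoped Classical

/-- Probability, when each point of F₂^m is erased independently with
probability p, that some nonzero codeword of RM(m,r) is supported on the
erased set (exactly the event that the erasure pattern is not uniquely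
decodable). -/
noncomputable def erasureFailProb (m r : ℕ) (p : ℝ) : ℝ :=
  ∑ S : Finset (Cube m),
    p ^ S.card * (1 - p) ^ (2 ^ m - S.card) *
      (if ∃ f ∈ RM m r, f ≠ 0 ∧ ∀ x, f x ≠ 0 → x ∈ S then 1 else 0)

/-- Probability, for a random error vector v with independent Bernoulli(p)
coordinates, that some nonzero codeword f of RM(m,r) satisfies
|v + F_f| ≤ |v| (the event containing maximum-likelihood decoding failure). -/
noncomputable def bscFailProb (m r : ℕ) (p : ℝ) : ℝ :=
  ∑ v : BF m,
    p ^ hammingNorm v * (1 - p) ^ (2 ^ m - hammingNorm v) *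
      (if ∃ f ∈ RM m r, f ≠ 0 ∧ hammingNorm (v + f) ≤ hammingNorm v then 1 else 0)

/-- Binary entropy function (base-2 logarithm). -/
noncomputable def binH (p : ℝ) : ℝ :=
  -p * Real.logb 2 p - (1 - p) * Real.logb 2 (1 - p)

section

variable {m : ℕ}

/-! ### Multilinear monomials -/

/-- The multilinear monomial `∏ i ∈ S, x i` as a Boolean function. -/
def monoFn (S : Finset (Fin m)) : BF m := fun x => ∏ i ∈ S, x i

/-- Functions spanned by the monomials whose index set lies in `D`. -/
noncomputable def monoSpan (D : Set (Finset (Fin m))) : Submodule (ZMod 2) (BF m) :=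
  Submodule.span (ZMod 2) (monoFn '' D)

lemma zmod_two_eq_one {a : ZMod 2} (h : a ≠ 0) : a = 1 := by
  revert a; decide

lemma zmod_two_pow {a : ZMod 2} {k : ℕ} (hk : k ≠ 0) : a ^ k = a := by
  by_cases h : a = 0
  · simp [h, hk]
  · simp [zmod_two_eq_one h]

lemma RM_repr {r : ℕ} {f : BF m} (hf : f ∈ RM m r) :
    ∃ c : Finset (Fin m) → ZMod 2, f = ∑ S with S.card ≤ r, c S • monoFn S := by
  obtain ⟨p, hp, hpf⟩ := hf
  refine ⟨fun S => ∑ d ∈ p.support with d.support = S, MvPolynomial.coeff d p, ?_⟩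
  ext x
  rw [← hpf x, MvPolynomial.eval_eq, Finset.sum_apply]
  rw [← Finset.sum_fiberwise_of_maps_to
    (g := fun d : Fin m →₀ ℕ => d.support) (t := univ.filter fun S => S.card ≤ r)]
  · refine Finset.sum_congr rfl fun S _ => ?_
    simp only [Pi.smul_apply, smul_eq_mul, Finset.sum_mul]
    refine Finset.sum_congr rfl fun d hd => ?_
    rw [Finset.mem_filter] at hd
    rw [monoFn, ← hd.2]
    congr 1
    exact Finset.prod_congr rfl fun i hi => zmod_two_pow (Finsupp.mem_support_iff.1 hi)
  · intro d hd
    rw [Finset.mem_filter]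
    refine ⟨Finset.mem_univ _, le_trans ?_ ((MvPolynomial.le_totalDegree hd).trans hp)⟩
    rw [Finset.card_eq_sum_ones, Finsupp.sum]
    exact Finset.sum_le_sum fun i hi => Nat.one_le_iff_ne_zero.2 (Finsupp.mem_support_iff.1 hi)

lemma RM_add {r : ℕ} {f g : BF m} (hf : f ∈ RM m r) (hg : g ∈ RM m r) : f + g ∈ RM m r := by
  obtain ⟨p, hp, hpf⟩ := hf
  obtain ⟨q, hq, hqg⟩ := hg
  exact ⟨p + q, (MvPolynomial.totalDegree_add _ _).trans (max_le hp hq),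
    fun x => by simp [hpf, hqg]⟩

lemma totalDegree_bind₁_le_of_linear {R σ τ : Type*} [CommSemiring R]
    (q : σ → MvPolynomial τ R) (hq : ∀ i, (q i).totalDegree ≤ 1) (p : MvPolynomial σ R) :
    (MvPolynomial.bind₁ q p).totalDegree ≤ p.totalDegree := by
  rw [MvPolynomial.bind₁, MvPolynomial.aeval_def, MvPolynomial.eval₂_eq]
  refine MvPolynomial.totalDegree_finsetSum_le fun d hd => ?_
  refine (MvPolynomial.totalDegree_mul _ _).trans ?_
  rw [MvPolynomial.algebraMap_eq, MvPolynomial.totalDegree_C, zero_add]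
  refine (MvPolynomial.totalDegree_finsetProd _ _).trans ?_
  refine le_trans ?_ (MvPolynomial.le_totalDegree hd)
  rw [Finsupp.sum]
  refine Finset.sum_le_sum fun i _ => (MvPolynomial.totalDegree_pow _ _).trans ?_
  exact (Nat.mul_le_mul_left _ (hq i)).trans (by simp)

lemma RM_comp {r : ℕ} {f : BF m} (hf : f ∈ RM m r) (L : Cube m →ₗ[ZMod 2] Cube m) :
    (fun x => f (L x)) ∈ RM m r := by
  obtain ⟨p, hp, hpf⟩ := hf
  let q : Fin m → MvPolynomial (Fin m) (ZMod 2) := fun i =>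
    ∑ j, MvPolynomial.C (L (Pi.single j 1) i) * MvPolynomial.X j
  refine ⟨MvPolynomial.bind₁ q p, (totalDegree_bind₁_le_of_linear q ?_ p).trans hp, fun x => ?_⟩
  · intro i
    refine MvPolynomial.totalDegree_finsetSum_le fun j _ => ?_
    refine (MvPolynomial.totalDegree_mul _ _).trans ?_
    simp
  · change _ = f (L x)
    rw [← hpf, ← MvPolynomial.coe_aeval_eq_eval, ← MvPolynomial.coe_aeval_eq_eval,
      RingHom.coe_coe, RingHom.coe_coe, MvPolynomial.aeval_bind₁]
    congr 2
    ext i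
    simp only [q, map_sum, map_mul, MvPolynomial.aeval_X, MvPolynomial.aeval_C, Algebra.algebraMap_self,
      RingHom.id_apply]
    have hx : x = ∑ j, x j • (Pi.single j (1 : ZMod 2) : Cube m) := by
      ext k; simp [Finset.sum_apply, Pi.single_apply]
    conv_rhs => rw [hx]
    simp [map_sum, Finset.sum_apply, mul_comm]

/-! ### Minimum distance on subcubes -/

/-- The points of the cube supported on `J`. -/
noncomputable def subCube (J : Finset (Fin m)) : Finset (Cube m) :=
  univ.filter fun u => ∀ i, i ∉ J → u i = 0

lemma mem_subCube {J : Finset (Fin m)} {u : Cube m} : u ∈ subCube J ↔ ∀ i, i ∉ J → u i = 0 := by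
  simp [subCube]

/-- The direction derivative along a basis vector. -/
def derivFn (j : Fin m) (g : BF m) : BF m := fun x => g (x + Pi.single j 1) + g x

lemma derivFn_monoFn (j : Fin m) (S : Finset (Fin m)) :
    derivFn j (monoFn S) = if j ∈ S then monoFn (S.erase j) else 0 := by
  ext x
  have hne : ∀ T : Finset (Fin m), j ∉ T → monoFn T (x + Pi.single j 1) = monoFn T x := by
    intro T hT
    refine Finset.prod_congr rfl fun i hi => ?_
    have : i ≠ j := fun h => hT (h ▸ hi)
    simp [this]
  split_ifs with h
  · have h2 : ∀ y, monoFn S y = y j * monoFn (S.erase j) y := fun y =>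
      (Finset.mul_prod_erase S (fun i => y i) h).symm
    simp only [derivFn, h2, hne _ (Finset.notMem_erase j S)]
    have : x j + x j = 0 := CharTwo.add_self_eq_zero _
    simp only [Pi.add_apply, Pi.single_eq_same]
    linear_combination monoFn (S.erase j) x * this
  · simp only [derivFn, hne S h]
    exact CharTwo.add_self_eq_zero _

lemma derivFn_mem {J : Finset (Fin m)} {j : Fin m} (hj : j ∉ J) {d : ℕ} {g : BF m}
    (hg : g ∈ monoSpan {S : Finset (Fin m) | (S ∩ insert j J).card ≤ d}) :
    derivFn j g ∈ monoSpan {S : Finset (Fin m) | (S ∩ J).card + 1 ≤ d} := by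
  refine Submodule.span_induction (p := fun g _ => derivFn j g ∈
    monoSpan {S : Finset (Fin m) | (S ∩ J).card + 1 ≤ d}) ?_ ?_ ?_ ?_ hg
  · rintro _ ⟨S, hS, rfl⟩
    rw [derivFn_monoFn]
    split_ifs with h
    · refine Submodule.subset_span ⟨_, ?_, rfl⟩
      simp only [Set.mem_ofPred_eq] at hS ⊢
      have : insert j (S.erase j ∩ J) ⊆ S ∩ insert j J := by
        intro i hi
        simp only [Finset.mem_insert, Finset.mem_inter, Finset.mem_erase] at hi ⊢
        rcases hi with rfl | hi
        · exact ⟨h, Or.inl rfl⟩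
        · exact ⟨hi.1.2, Or.inr hi.2⟩
      have h2 := Finset.card_le_card this
      rw [Finset.card_insert_of_notMem (by simp [hj])] at h2
      omega
    · exact Submodule.zero_mem _
  · have : derivFn j (0 : BF m) = 0 := by ext; simp [derivFn]
    rw [this]; exact Submodule.zero_mem _
  · intro a b _ _ ha hb
    have : derivFn j (a + b) = derivFn j a + derivFn j b := by
      ext; simp [derivFn]; ring
    rw [this]; exact Submodule.add_mem _ ha hb
  · intro c a _ ha
    have : derivFn j (c • a) = c • derivFn j a := by
      ext; simp [derivFn]; ring
    rw [this]; exact Submodule.smul_mem _ _ ha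

lemma monoSpan_mono {D E : Set (Finset (Fin m))} (h : D ⊆ E) : monoSpan D ≤ monoSpan E :=
  Submodule.span_mono (Set.image_mono h)

/-- The minimum distance of Reed–Muller codes, on a translate of a coordinate subcube. -/
lemma two_pow_le_card_subCube (J : Finset (Fin m)) : ∀ (d : ℕ) (g : BF m),
    g ∈ monoSpan {S : Finset (Fin m) | (S ∩ J).card ≤ d} → ∀ z, g z ≠ 0 →
    2 ^ J.card ≤ 2 ^ d * ((subCube J).filter fun u => g (z + u) ≠ 0).card := by
  induction J using Finset.induction_on with
  | empty =>
    intro d g _ z hz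
    have : (0 : Cube m) ∈ (subCube ∅).filter fun u => g (z + u) ≠ 0 := by
      simp [mem_subCube, hz]
    have h1 := Finset.card_pos.2 ⟨_, this⟩
    have h2 : 0 < 2 ^ d := by positivity
    rw [Finset.card_empty, pow_zero]
    exact Nat.mul_pos h2 h1
  | insert j J hj ih =>
    intro d g hg z hz
    set e : Cube m := Pi.single j 1 with he
    have hsub : ∀ (z' : Cube m) (h : BF m), (∀ u ∈ subCube J, h (z' + u) = g (z' + u)) →
        ((subCube J).filter fun u => h (z' + u) ≠ 0).card =
        ((subCube J).filter fun u => g (z' + u) ≠ 0).card := by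
      intro z' h hh
      congr 1
      exact Finset.filter_congr fun u hu => by rw [hh u hu]
    have hle0 : ((subCube J).filter fun u => g (z + u) ≠ 0).card ≤
        ((subCube (insert j J)).filter fun u => g (z + u) ≠ 0).card := by
      refine Finset.card_le_card fun u hu => ?_
      simp only [Finset.mem_filter, mem_subCube, Finset.mem_insert, not_or] at hu ⊢
      exact ⟨fun i hi => hu.1 i hi.2, hu.2⟩
    have hsum : ((subCube J).filter fun u => g (z + u) ≠ 0).card +
        ((subCube J).filter fun u => g (z + e + u) ≠ 0).card ≤
        ((subCube (insert j J)).filter fun u => g (z + u) ≠ 0).card := by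
      have hinj : Function.Injective fun u : Cube m => e + u := add_right_injective e
      rw [← Finset.card_image_of_injective
        ((subCube J).filter fun u => g (z + e + u) ≠ 0) hinj, ← Finset.card_union_of_disjoint]
      · refine Finset.card_le_card fun u hu => ?_
        simp only [Finset.mem_union, Finset.mem_image, Finset.mem_filter, mem_subCube,
          Finset.mem_insert, not_or] at hu ⊢
        rcases hu with hu | ⟨u, hu, rfl⟩
        · exact ⟨fun i hi => hu.1 i hi.2, hu.2⟩
        · exact ⟨fun i hi => by simp [he, hi.1, hu.1 i hi.2], by rw [← add_assoc]; exact hu.2⟩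
      · rw [Finset.disjoint_left]
        intro u hu hu'
        simp only [Finset.mem_image, Finset.mem_filter, mem_subCube] at hu hu'
        obtain ⟨u', hu', rfl⟩ := hu'
        have h1 := hu.1 j hj
        have h2 := hu'.1 j hj
        simp [he, h2] at h1
    have hg' : g ∈ monoSpan {S : Finset (Fin m) | (S ∩ J).card ≤ d} := by
      refine monoSpan_mono (fun S hS => ?_) hg
      exact (Finset.card_le_card (Finset.inter_subset_inter_left
        (Finset.subset_insert j J))).trans hS
    rw [Finset.card_insert_of_notMem hj, pow_succ]
    by_cases hex : ∃ u ∈ subCube J, g (z + e + u) ≠ 0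
    · obtain ⟨u₀, hu₀, hgu⟩ := hex
      have h1 := ih d g hg' z hz
      have h2 := ih d g hg' (z + e + u₀) hgu
      have h3 : ((subCube J).filter fun u => g (z + e + u₀ + u) ≠ 0).card =
          ((subCube J).filter fun u => g (z + e + u) ≠ 0).card := by
        refine Finset.card_bij (fun u _ => u₀ + u) ?_ ?_ ?_
        · intro u hu
          simp only [Finset.mem_filter, mem_subCube] at hu hu₀ ⊢
          exact ⟨fun i hi => by simp [hu.1 i hi, hu₀ i hi], by rw [← add_assoc]; exact hu.2⟩
        · intro a _ b _ hab
          exact add_left_cancel hab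
        · intro u hu
          simp only [Finset.mem_filter, mem_subCube] at hu hu₀ ⊢
          refine ⟨u - u₀, ⟨fun i hi => by simp [hu.1 i hi, hu₀ i hi], ?_⟩, by abel⟩
          have : z + e + u₀ + (u - u₀) = z + e + u := by abel
          rw [this]; exact hu.2
      rw [h3] at h2
      calc 2 ^ J.card * 2 = 2 ^ J.card + 2 ^ J.card := by ring
        _ ≤ _ := add_le_add h1 h2
        _ = 2 ^ d * (_ + _) := (mul_add _ _ _).symm
        _ ≤ _ := Nat.mul_le_mul_left _ hsum
    · push Not at hex
      have hder := derivFn_mem hj hg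
      have hh : ∀ u ∈ subCube J, derivFn j g (z + u) = g (z + u) := by
        intro u hu
        have : z + u + e = z + e + u := by abel
        rw [derivFn, ← he, this, hex u hu, zero_add]
      have h0 : derivFn j g z ≠ 0 := by
        have := hh 0 (by simp [mem_subCube])
        rw [add_zero] at this
        rwa [this]
      rcases d with _ | d
      · exfalso
        apply h0
        have : {S : Finset (Fin m) | (S ∩ J).card + 1 ≤ 0} = ∅ := by ext; simp
        rw [this, monoSpan, Set.image_empty, Submodule.span_empty, Submodule.mem_bot] at hder
        rw [hder]; rfl
      · have h1 := ih d (derivFn j g) (monoSpan_mono (fun S hS => by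
          simpa using hS) hder) z h0
        rw [hsub z _ hh] at h1
        calc 2 ^ J.card * 2 ≤ (2 ^ d * _) * 2 := Nat.mul_le_mul_right _ h1
          _ = 2 ^ (d + 1) * _ := by ring
          _ ≤ _ := Nat.mul_le_mul_left _ hle0

end

section

variable {m : ℕ}

/-! ### A pairwise independent family of linear automorphisms -/

lemma exists_linear_family (hm : m ≠ 0) : ∃ (ι : Type) (_ : Fintype ι)
    (L : ι → Cube m ≃ₗ[ZMod 2] Cube m), Fintype.card ι + 1 = 2 ^ m ∧
    ∀ u ≠ 0, ∀ φ : Cube m → ℝ, ∑ i, φ (L i u) = ∑ y with y ≠ 0, φ y := by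
  have : Fact (Nat.Prime 2) := ⟨Nat.prime_two⟩
  let F := GaloisField 2 m
  have : Fintype F := Fintype.ofFinite F
  have hfin : Module.finrank (ZMod 2) F = Module.finrank (ZMod 2) (Cube m) := by
    rw [GaloisField.finrank 2 hm]; simp
  let e : F ≃ₗ[ZMod 2] Cube m := LinearEquiv.ofFinrankEq _ _ hfin
  let μ : Fˣ → (F ≃ₗ[ZMod 2] F) := fun a =>
    LinearEquiv.ofBijective (LinearMap.mulLeft (ZMod 2) (a : F)) (mulLeft_bijective₀ _ a.ne_zero)
  refine ⟨Fˣ, inferInstance, fun a => e.symm.trans ((μ a).trans e), ?_, ?_⟩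
  · have h1 : Fintype.card F = 2 ^ m := by
      rw [← Nat.card_eq_fintype_card]; exact GaloisField.card 2 m hm
    rw [Fintype.card_units, h1]
    exact Nat.sub_add_cancel Nat.one_le_two_pow
  · intro u hu φ
    refine Finset.sum_bij (fun a _ => e ((a : F) * e.symm u)) ?_ ?_ ?_ ?_
    · intro a _
      have : e.symm u ≠ 0 := by simpa using hu
      simp [this]
    · intro a _ b _ hab
      have h0 : e.symm u ≠ 0 := by simpa using hu
      exact Units.ext (mul_right_cancel₀ h0 (e.injective hab))
    · intro y hy
      have h0 : e.symm u ≠ 0 := by simpa using hu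
      have h1 : e.symm y ≠ 0 := by simpa using hy
      refine ⟨Units.mk0 (e.symm y / e.symm u) (div_ne_zero h1 h0), Finset.mem_univ _, ?_⟩
      simp [div_mul_cancel₀ _ h0]
    · intro a _
      rfl

lemma exists_sum_sq_le (hm : m ≠ 0) : ∃ (ι : Type) (_ : Fintype ι)
    (L : ι → Cube m ≃ₗ[ZMod 2] Cube m), Fintype.card ι ≤ 2 ^ m ∧
    ∀ (U : Finset (Cube m)) (φ : Cube m → ℝ), ∑ x, φ x = 0 →
      ∃ i, ∑ x, (∑ u ∈ U, φ (L i (x + u))) ^ 2 ≤ U.card * ∑ x, φ x ^ 2 := by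
  obtain ⟨ι, hι, L, hcard, hL⟩ := exists_linear_family hm
  refine ⟨ι, hι, L, by omega, fun U φ hφ => ?_⟩
  have hne : Nonempty ι := by
    rw [← Fintype.card_pos_iff]
    have : 2 ^ 1 ≤ 2 ^ m := Nat.pow_le_pow_right (by norm_num) (Nat.one_le_iff_ne_zero.2 hm)
    omega
  let A : Cube m → ℝ := fun y => ∑ x, φ x * φ (x + y)
  have hA0 : A 0 = ∑ x, φ x ^ 2 := by
    simp [A, sq]
  have hA0n : 0 ≤ A 0 := by rw [hA0]; positivity
  have hshift : ∀ x, ∑ y, φ (x + y) = 0 := fun x => by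
    rw [← hφ]; exact Equiv.sum_comp (Equiv.addLeft x) φ
  have hAsum : ∑ y, A y = 0 := by
    simp only [A]
    rw [Finset.sum_comm]
    simp [← Finset.mul_sum, hshift]
  have hAne : ∑ y with y ≠ 0, A y ≤ 0 := by
    rw [← Finset.sum_filter_add_sum_filter_not univ (fun y : Cube m => y ≠ 0)] at hAsum
    have : ∑ y with ¬ y ≠ (0 : Cube m), A y = A 0 := by
      simp [Finset.sum_filter]
    linarith
  have hinner : ∀ i, ∑ x, (∑ u ∈ U, φ (L i (x + u))) ^ 2 =
      ∑ u ∈ U, ∑ u' ∈ U, A (L i (u' - u)) := by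
    intro i
    simp only [sq, Finset.sum_mul_sum]
    rw [Finset.sum_comm]
    refine Finset.sum_congr rfl fun u _ => ?_
    rw [Finset.sum_comm]
    refine Finset.sum_congr rfl fun u' _ => ?_
    have := Equiv.sum_comp ((Equiv.addRight u).trans (L i).toEquiv)
      (fun x => φ x * φ (x + L i (u' - u)))
    simp only [A]
    rw [← this]
    refine Finset.sum_congr rfl fun x _ => ?_
    have h2 : L i (x + u) + L i (u' - u) = L i (x + u') := by
      rw [← map_add]; congr 1; abel
    simp [-map_add, -map_sub, h2]
  have htot : ∑ i, ∑ x, (∑ u ∈ U, φ (L i (x + u))) ^ 2 ≤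
      ∑ _i : ι, (U.card * ∑ x, φ x ^ 2 : ℝ) := by
    simp only [hinner]
    rw [Finset.sum_comm]
    have hpair : ∀ u ∈ U, ∑ i, ∑ u' ∈ U, A (L i (u' - u)) ≤ Fintype.card ι * A 0 := by
      intro u hu
      rw [Finset.sum_comm]
      calc ∑ u' ∈ U, ∑ i, A (L i (u' - u))
          ≤ ∑ u' ∈ U, if u' = u then (Fintype.card ι * A 0 : ℝ) else 0 := by
            refine Finset.sum_le_sum fun u' _ => ?_
            split_ifs with h
            · simp [h]
            · rw [hL (u' - u) (sub_ne_zero.2 h)]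
              exact hAne
        _ = _ := by simp [hu]
    refine (Finset.sum_le_sum hpair).trans (le_of_eq ?_)
    simp [hA0]
    ring
  obtain ⟨i, -, hi⟩ := Finset.exists_le_of_sum_le Finset.univ_nonempty htot
  exact ⟨i, hi⟩

/-! ### One step of the weight recursion -/

/-- The support of a Boolean function. -/
noncomputable def nz (f : BF m) : Finset (Cube m) := univ.filter fun x => f x ≠ 0

/-- The codewords of `RM(m,r)` of normalized weight at most `b`. -/
noncomputable def lowW (m r : ℕ) (b : ℝ) : Finset (BF m) :=
  univ.filter fun f => f ∈ RM m r ∧ ((nz f).card : ℝ) ≤ b * 2 ^ m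

lemma mem_lowW {r : ℕ} {b : ℝ} {f : BF m} :
    f ∈ lowW m r b ↔ f ∈ RM m r ∧ ((nz f).card : ℝ) ≤ b * 2 ^ m := by simp [lowW]

/-- The points whose `J`-subcube carries at least a `2⁻ˢ` fraction of the support of `g`. -/
noncomputable def heavyPts (J : Finset (Fin m)) (s : ℕ) (g : BF m) : Finset (Cube m) :=
  univ.filter fun x => 2 ^ J.card ≤ 2 ^ s * ((subCube J).filter fun u => g (x + u) ≠ 0).card

lemma card_subCube (J : Finset (Fin m)) : (subCube J).card = 2 ^ J.card := by
  have : Fintype.card (J → ZMod 2) = 2 ^ J.card := by simp [ZMod.card]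
  rw [← this, ← Finset.card_univ]
  refine Finset.card_bij (fun u _ j => u j) (fun _ _ => Finset.mem_univ _) ?_ ?_
  · intro a ha b hb hab
    ext i
    by_cases hi : i ∈ J
    · exact congrFun hab ⟨i, hi⟩
    · rw [mem_subCube.1 ha i hi, mem_subCube.1 hb i hi]
  · intro b _
    refine ⟨fun i => if h : i ∈ J then b ⟨i, h⟩ else 0, ?_, ?_⟩
    · rw [mem_subCube]
      intro i hi
      simp [hi]
    · ext j
      simp

lemma card_nz_le (f : BF m) : (nz f).card ≤ 2 ^ m := by
  refine (Finset.card_le_univ _).trans (le_of_eq ?_)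
  simp [ZMod.card]

/-- The second moment bound for heavy points, with `β` the normalized weight of `f`. -/
lemma card_heavyPts_le (J : Finset (Fin m)) (s : ℕ) (g : BF m) (φ : Cube m → ℝ) (β : ℝ)
    (hφ : ∀ x, φ x = (if g x ≠ 0 then 1 else 0) - β) (hβ : β < 1 / 2 ^ s) (V : ℝ)
    (hV : ∑ x, (∑ u ∈ subCube J, φ (x + u)) ^ 2 ≤ 2 ^ J.card * V) :
    ((heavyPts J s g).card : ℝ) * (2 ^ J.card * (1 / 2 ^ s - β) ^ 2) ≤ V := by
  have hpow : (0 : ℝ) < 2 ^ J.card := by positivity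
  have h1 : ∀ x ∈ heavyPts J s g,
      (2 ^ J.card * (1 / 2 ^ s - β)) ^ 2 ≤ (∑ u ∈ subCube J, φ (x + u)) ^ 2 := by
    intro x hx
    have hx' : (2 : ℝ) ^ J.card ≤ 2 ^ s * ((subCube J).filter fun u => g (x + u) ≠ 0).card := by
      have := (Finset.mem_filter.1 hx).2
      exact_mod_cast this
    have hsum : ∑ u ∈ subCube J, φ (x + u) =
        ((subCube J).filter fun u => g (x + u) ≠ 0).card - 2 ^ J.card * β := by
      simp only [hφ, Finset.sum_sub_distrib, Finset.sum_const, card_subCube, nsmul_eq_mul]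
      rw [Finset.sum_boole]
      push_cast
      rfl
    rw [hsum]
    have h2 : (2 : ℝ) ^ J.card * (1 / 2 ^ s) ≤
        ((subCube J).filter fun u => g (x + u) ≠ 0).card := by
      rw [mul_one_div, div_le_iff₀ (by positivity)]
      linarith
    have h3 : 0 ≤ (2 : ℝ) ^ J.card * (1 / 2 ^ s - β) :=
      mul_nonneg hpow.le (sub_nonneg.2 hβ.le)
    refine pow_le_pow_left₀ h3 ?_ 2
    linarith
  have h2 : ((heavyPts J s g).card : ℝ) * (2 ^ J.card * (1 / 2 ^ s - β)) ^ 2 ≤ 2 ^ J.card * V := by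
    refine le_trans ?_ hV
    rw [← nsmul_eq_mul, ← Finset.sum_const]
    exact (Finset.sum_le_sum h1).trans
      (Finset.sum_le_sum_of_subset_of_nonneg (Finset.subset_univ _) fun _ _ _ => sq_nonneg _)
  have h3 : (2 : ℝ) ^ J.card * (((heavyPts J s g).card : ℝ) *
      (2 ^ J.card * (1 / 2 ^ s - β) ^ 2)) ≤ 2 ^ J.card * V := by
    refine le_trans (le_of_eq ?_) h2
    ring
  exact le_of_mul_le_mul_left h3 hpow

lemma nz_add_subset_heavyPts {J : Finset (Fin m)} {s : ℕ} (hs : 1 ≤ s) {f g : BF m}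
    (h : f + g ∈ monoSpan {S : Finset (Fin m) | (S ∩ J).card < s}) :
    nz (f + g) ⊆ heavyPts J s f ∪ heavyPts J s g := by
  intro x hx
  by_contra hcon
  simp only [Finset.mem_union, heavyPts, Finset.mem_filter, Finset.mem_univ, true_and,
    not_or, not_le] at hcon
  obtain ⟨d, rfl⟩ : ∃ d, s = d + 1 := ⟨s - 1, by omega⟩
  have h1 := two_pow_le_card_subCube J d (f + g)
    (monoSpan_mono (fun S hS => Nat.lt_succ_iff.1 hS) h) x (by simpa [nz] using hx)
  have h2 : ((subCube J).filter fun u => (f + g) (x + u) ≠ 0).card ≤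
      ((subCube J).filter fun u => f (x + u) ≠ 0).card +
      ((subCube J).filter fun u => g (x + u) ≠ 0).card := by
    rw [← Finset.card_union_add_card_inter]
    refine le_trans (Finset.card_le_card fun u hu => ?_) (Nat.le_add_right _ _)
    simp only [Finset.mem_union, Finset.mem_filter] at hu ⊢
    by_contra hc
    push Not at hc
    apply hu.2
    rw [Pi.add_apply, hc.1 hu.1, hc.2 hu.1, add_zero]
  have h3 := Nat.mul_le_mul_left (2 ^ d) h2
  rw [pow_succ] at hcon
  nlinarith

lemma card_few_heavyPts_le (r s : ℕ) (hs : 1 ≤ s) (J : Finset (Fin m)) (b : ℝ) :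
    (univ.filter fun g : BF m => g ∈ RM m r ∧ 2 * ((heavyPts J s g).card : ℝ) ≤ b * 2 ^ m).card ≤
    (lowW m r b).card *
      2 ^ (univ.filter fun S : Finset (Fin m) => S.card ≤ r ∧ s ≤ (S ∩ J).card).card := by
  set D := univ.filter fun S : Finset (Fin m) => S.card ≤ r ∧ s ≤ (S ∩ J).card with hD
  have hex : ∀ g : BF m, ∃ c : Finset (Fin m) → ZMod 2, g ∈ RM m r →
      g = ∑ S with S.card ≤ r, c S • monoFn S := by
    intro g
    by_cases hg : g ∈ RM m r
    · obtain ⟨c, hc⟩ := RM_repr hg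
      exact ⟨c, fun _ => hc⟩
    · exact ⟨0, fun h => absurd h hg⟩
  choose c hc using hex
  have hcard : (univ : Finset (D → ZMod 2)).card = 2 ^ D.card := by
    simp [ZMod.card]
  rw [← hcard]
  refine Finset.card_le_mul_card_image_of_maps_to (f := fun g (S : D) => c g S)
    (fun _ _ => Finset.mem_univ _) _ fun κ _ => ?_
  rcases Finset.eq_empty_or_nonempty ((univ.filter fun g : BF m => g ∈ RM m r ∧
    2 * ((heavyPts J s g).card : ℝ) ≤ b * 2 ^ m).filter fun g => (fun S : D => c g S) = κ)
    with h | ⟨g₀, hg₀⟩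
  · rw [h]; simp
  refine Finset.card_le_card_of_injOn (fun g => g + g₀) ?_ fun a _ b _ hab => add_right_cancel hab
  intro g hg
  rw [Finset.mem_coe, mem_lowW]
  simp only [Finset.coe_filter, Finset.mem_filter, Finset.mem_univ, true_and,
    Set.mem_ofPred_eq] at hg hg₀
  refine ⟨RM_add hg.1.1 hg₀.1.1, ?_⟩
  have hspan : g + g₀ ∈ monoSpan {S : Finset (Fin m) | (S ∩ J).card < s} := by
    rw [hc g hg.1.1, hc g₀ hg₀.1.1, ← Finset.sum_add_distrib]
    refine Submodule.sum_mem _ fun S hS => ?_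
    rw [← add_smul]
    by_cases hSJ : (S ∩ J).card < s
    · exact Submodule.smul_mem _ _ (Submodule.subset_span ⟨S, hSJ, rfl⟩)
    · have hSD : S ∈ D := by
        rw [hD, Finset.mem_filter]
        exact ⟨Finset.mem_univ _, (Finset.mem_filter.1 hS).2, not_lt.1 hSJ⟩
      have : c g S = c g₀ S := congrFun (hg.2.trans hg₀.2.symm) ⟨S, hSD⟩
      rw [this, CharTwo.add_self_eq_zero, zero_smul]
      exact Submodule.zero_mem _
  have h1 : (nz (g + g₀)).card ≤ (heavyPts J s g).card + (heavyPts J s g₀).card :=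
    (Finset.card_le_card (nz_add_subset_heavyPts hs hspan)).trans (Finset.card_union_le _ _)
  have h2 : ((nz (g + g₀)).card : ℝ) ≤ (heavyPts J s g).card + (heavyPts J s g₀).card := by
    exact_mod_cast h1
  linarith [hg.1.2, hg₀.1.2]

lemma sum_centered_indicator (f : BF m) :
    ∑ x, ((if f x ≠ 0 then (1 : ℝ) else 0) - ((nz f).card : ℝ) / (2 : ℝ) ^ m) = 0 := by
  rw [Finset.sum_sub_distrib, Finset.sum_boole]
  simp [nz, ZMod.card]
  field_simp
  simp

lemma sum_centered_indicator_sq (f : BF m) :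
    ∑ x, ((if f x ≠ 0 then (1 : ℝ) else 0) - ((nz f).card : ℝ) / (2 : ℝ) ^ m) ^ 2 =
    (2 : ℝ) ^ m * (((nz f).card : ℝ) / (2 : ℝ) ^ m * (1 - ((nz f).card : ℝ) / (2 : ℝ) ^ m)) := by
  set β : ℝ := (nz f).card / 2 ^ m with hβ
  have h1 : ∀ x, ((if f x ≠ 0 then (1 : ℝ) else 0) - β) ^ 2 =
      ((if f x ≠ 0 then (1 : ℝ) else 0) - β) * (1 - 2 * β) + (β - β ^ 2) := by
    intro x; split_ifs <;> ring
  simp only [h1]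
  rw [Finset.sum_add_distrib, ← Finset.sum_mul, sum_centered_indicator]
  simp [ZMod.card]
  ring

/-- One step of the weight recursion: a codeword of weight `b` is determined, up to an error
of weight `b'`, by a linear automorphism and its coefficients of degree at least `s` in `J`. -/
lemma card_lowW_le (hm : m ≠ 0) (r s : ℕ) (hs : 1 ≤ s) (J : Finset (Fin m)) (b b' : ℝ)
    (hb : b < 1 / 2 ^ s)
    (hb' : 2 * (b * (1 - b)) ≤ b' * (2 ^ J.card * (1 / 2 ^ s - b) ^ 2)) :
    (lowW m r b).card ≤ 2 ^ m * ((lowW m r b').card *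
      2 ^ (univ.filter fun S : Finset (Fin m) => S.card ≤ r ∧ s ≤ (S ∩ J).card).card) := by
  obtain ⟨ι, hι, L, hcard, hL⟩ := exists_sum_sq_le hm
  set H := univ.filter fun g : BF m => g ∈ RM m r ∧
    2 * ((heavyPts J s g).card : ℝ) ≤ b' * 2 ^ m with hH
  have hpos : (0 : ℝ) < 2 ^ J.card * (1 / 2 ^ s - b) ^ 2 := by
    have := sub_pos.2 hb
    positivity
  have hsub : lowW m r b ⊆ univ.biUnion fun i : ι =>
      H.image fun g x => g ((L i).symm x) := by
    intro f hf
    obtain ⟨hfR, hfw⟩ := mem_lowW.1 hf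
    set β : ℝ := (nz f).card / 2 ^ m with hβ
    have hβb : β ≤ b := by rw [hβ, div_le_iff₀ (by positivity)]; exact hfw
    have hβ0 : 0 ≤ β := by positivity
    obtain ⟨i, hi⟩ := hL (subCube J) (fun x => (if f x ≠ 0 then (1 : ℝ) else 0) - β)
      (sum_centered_indicator f)
    rw [sum_centered_indicator_sq, card_subCube, ← hβ] at hi
    push_cast at hi
    have hheavy := card_heavyPts_le J s (fun x => f (L i x))
      (fun x => (if f (L i x) ≠ 0 then (1 : ℝ) else 0) - β) β (fun _ => rfl)
      (hβb.trans_lt hb) _ hi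
    rw [Finset.mem_biUnion]
    refine ⟨i, Finset.mem_univ _, Finset.mem_image.2 ⟨fun x => f (L i x), ?_, ?_⟩⟩
    · rw [hH, Finset.mem_filter]
      refine ⟨Finset.mem_univ _, RM_comp hfR (L i).toLinearMap, ?_⟩
      have hs2 : (1 : ℝ) / 2 ^ s ≤ 1 / 2 := by
        have : (2 : ℝ) ^ 1 ≤ 2 ^ s := pow_le_pow_right₀ (by norm_num) hs
        exact one_div_le_one_div_of_le (by norm_num) (by linarith)
      have h1 : β * (1 - β) ≤ b * (1 - b) := by nlinarith
      have h2 : (1 / 2 ^ s - b) ^ 2 ≤ (1 / 2 ^ s - β) ^ 2 :=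
        pow_le_pow_left₀ (by linarith) (by linarith) 2
      have h3 : ((heavyPts J s fun x => f (L i x)).card : ℝ) *
          (2 ^ J.card * (1 / 2 ^ s - b) ^ 2) ≤ 2 ^ m * (b * (1 - b)) := by
        refine le_trans ?_ (hheavy.trans ?_)
        · gcongr
        · gcongr
      refine le_of_mul_le_mul_right ?_ hpos
      calc 2 * ((heavyPts J s fun x => f (L i x)).card : ℝ) * (2 ^ J.card * (1 / 2 ^ s - b) ^ 2)
          ≤ 2 ^ m * (2 * (b * (1 - b))) := by linarith
        _ ≤ 2 ^ m * (b' * (2 ^ J.card * (1 / 2 ^ s - b) ^ 2)) := by gcongr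
        _ = _ := by ring
    · ext x
      simp
  calc (lowW m r b).card ≤ _ := Finset.card_le_card hsub
    _ ≤ ∑ i : ι, (H.image fun g x => g ((L i).symm x)).card := Finset.card_biUnion_le
    _ ≤ ∑ _i : ι, H.card := Finset.sum_le_sum fun i _ => Finset.card_image_le
    _ = Fintype.card ι * H.card := by simp
    _ ≤ 2 ^ m * _ := Nat.mul_le_mul hcard (card_few_heavyPts_le r s hs J b')

end

/-! ### Counting monomials -/

lemma card_powerset_filter_card_le {α : Type*} (A : Finset α) (k : ℕ) :
    (A.powerset.filter fun S => S.card ≤ k).card = binomLe A.card k := by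
  have : A.powerset.filter (fun S => S.card ≤ k) =
      (Finset.range (k + 1)).biUnion fun i => A.powersetCard i := by
    ext S
    simp [Finset.mem_powersetCard, and_comm]
  rw [this, Finset.card_biUnion, binomLe]
  · simp [Finset.card_powersetCard]
  · intro i _ j _ hij
    exact Finset.pairwise_disjoint_powersetCard A hij

lemma card_filter_card_le (m k : ℕ) :
    (univ.filter fun S : Finset (Fin m) => S.card ≤ k).card = binomLe m k := by
  have := card_powerset_filter_card_le (univ : Finset (Fin m)) k
  rwa [Finset.powerset_univ, Finset.card_univ, Fintype.card_fin] at this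

lemma binomLe_le_two_pow (m k : ℕ) : binomLe m k ≤ 2 ^ m := by
  rw [← card_filter_card_le]
  refine (Finset.card_le_univ _).trans (le_of_eq ?_)
  simp

lemma binomLe_succ_succ (m k : ℕ) :
    binomLe (m + 1) (k + 1) = binomLe m (k + 1) + binomLe m k := by
  unfold binomLe
  rw [Finset.sum_range_succ', Finset.sum_range_succ' _ (k + 1)]
  simp only [Nat.choose_succ_succ, Finset.sum_add_distrib, Nat.choose_zero_right]
  ring

lemma succ_mul_binomLe_le (m k : ℕ) :
    (m + 1) * binomLe m k ≤ (k + 1) * binomLe (m + 1) (k + 1) := by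
  unfold binomLe
  rw [Finset.mul_sum, Finset.sum_range_succ' _ (k + 1), mul_add, Finset.mul_sum]
  refine le_trans (Finset.sum_le_sum fun i hi => ?_) (Nat.le_add_right _ _)
  rw [Nat.add_one_mul_choose_eq, mul_comm]
  exact Nat.mul_le_mul_right _ (Finset.mem_range.1 hi)

/-- Monomials containing `s` given variables form at most a `θˢ` fraction of all monomials. -/
lemma binomLe_sub_le {θ : ℝ} (hθ0 : 0 ≤ θ) (hθ1 : θ ≤ 1) (s : ℕ) : ∀ (m r : ℕ), s ≤ r → s ≤ m →
    (r : ℝ) ≤ θ * m → (binomLe (m - s) (r - s) : ℝ) ≤ θ ^ s * binomLe m r := by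
  induction s with
  | zero => intro m r _ _ _; simp
  | succ s ih =>
    intro m r hr hm h
    obtain ⟨r, rfl⟩ : ∃ r', r = r' + 1 := ⟨r - 1, by omega⟩
    obtain ⟨m, rfl⟩ : ∃ m', m = m' + 1 := ⟨m - 1, by omega⟩
    push_cast at h
    have h1 := ih m r (by omega) (by omega) (by nlinarith)
    have h2 : ((m : ℝ) + 1) * binomLe m r ≤ (r + 1) * binomLe (m + 1) (r + 1) := by
      exact_mod_cast succ_mul_binomLe_le m r
    have hB : (0 : ℝ) ≤ binomLe (m + 1) (r + 1) := Nat.cast_nonneg _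
    have h3 : (binomLe m r : ℝ) ≤ θ * binomLe (m + 1) (r + 1) := by
      have hm0 : (0 : ℝ) < (m : ℝ) + 1 := by positivity
      refine le_of_mul_le_mul_left ?_ hm0
      calc ((m : ℝ) + 1) * binomLe m r ≤ (r + 1) * binomLe (m + 1) (r + 1) := h2
        _ ≤ (θ * (m + 1)) * binomLe (m + 1) (r + 1) := by gcongr
        _ = _ := by ring
    rw [Nat.add_sub_add_right, Nat.add_sub_add_right]
    calc (binomLe (m - s) (r - s) : ℝ) ≤ θ ^ s * binomLe m r := h1
      _ ≤ θ ^ s * (θ * binomLe (m + 1) (r + 1)) := by gcongr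
      _ = _ := by ring

/-- Dropping `t` variables keeps at least a `(1-θ)ᵗ` fraction of all monomials. -/
lemma le_binomLe_sub {θ : ℝ} (hθ0 : 0 ≤ θ) (hθ1 : θ ≤ 1) (r t : ℕ) : ∀ m : ℕ, t ≤ m →
    (r : ℝ) ≤ θ * ((m : ℝ) - t) → (1 - θ) ^ t * binomLe m r ≤ binomLe (m - t) r := by
  induction t with
  | zero => intro m _ _; simp
  | succ t ih =>
    intro m hm h
    obtain ⟨m, rfl⟩ : ∃ m', m = m' + 1 := ⟨m - 1, by omega⟩
    push_cast at h
    have hmt : (0 : ℝ) ≤ (m : ℝ) - t := by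
      rw [sub_nonneg]; exact_mod_cast Nat.le_of_succ_le_succ hm
    have hr0 : (0 : ℝ) ≤ r := Nat.cast_nonneg _
    have h1 := ih m (by omega) (by linarith)
    have h2 : (1 - θ) * binomLe (m + 1) r ≤ binomLe m r := by
      rcases r with _ | r
      · simp [binomLe, hθ0]
      · have h3 : ((m : ℝ) + 1) * binomLe m r ≤ (r + 1) * binomLe (m + 1) (r + 1) := by
          exact_mod_cast succ_mul_binomLe_le m r
        have h4 : (binomLe (m + 1) (r + 1) : ℝ) = binomLe m (r + 1) + binomLe m r := by
          exact_mod_cast binomLe_succ_succ m r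
        have h5 : (binomLe m r : ℝ) ≤ θ * binomLe (m + 1) (r + 1) := by
          have hm0 : (0 : ℝ) < (m : ℝ) + 1 := by positivity
          have ht0 : (0 : ℝ) ≤ t := Nat.cast_nonneg t
          refine le_of_mul_le_mul_left ?_ hm0
          calc ((m : ℝ) + 1) * binomLe m r ≤ (r + 1) * binomLe (m + 1) (r + 1) := h3
            _ ≤ (θ * (m + 1)) * binomLe (m + 1) (r + 1) := by
              gcongr
              push_cast at h
              nlinarith
            _ = _ := by ring
        linarith
    rw [Nat.add_sub_add_right]
    calc (1 - θ) ^ (t + 1) * binomLe (m + 1) r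
        = (1 - θ) ^ t * ((1 - θ) * binomLe (m + 1) r) := by ring
      _ ≤ (1 - θ) ^ t * binomLe m r := by
        have : 0 ≤ 1 - θ := by linarith
        gcongr
      _ ≤ _ := h1

/-- The number of monomials of degree at most `r` with at least `s` variables from `J`. -/
lemma card_monomials_le {m : ℕ} {θ : ℝ} (hθ0 : 0 ≤ θ) (hθ1 : θ ≤ 1) (r s : ℕ) (hsr : s ≤ r)
    (hsm : s ≤ m) (hr : (r : ℝ) ≤ θ * m) (J : Finset (Fin m)) :
    ((univ.filter fun S : Finset (Fin m) => S.card ≤ r ∧ s ≤ (S ∩ J).card).card : ℝ) ≤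
      J.card.choose s * (θ ^ s * binomLe m r) := by
  have hsub : (univ.filter fun S : Finset (Fin m) => S.card ≤ r ∧ s ≤ (S ∩ J).card) ⊆
      (J.powersetCard s).biUnion fun I =>
        (((univ \ I).powerset.filter fun S => S.card ≤ r - s).image fun S => S ∪ I) := by
    intro S hS
    simp only [Finset.mem_filter, Finset.mem_univ, true_and] at hS
    obtain ⟨I, hI, hIc⟩ := Finset.exists_subset_card_eq hS.2
    have hIS : I ⊆ S := hI.trans Finset.inter_subset_left
    simp only [Finset.mem_biUnion, Finset.mem_image, Finset.mem_filter, Finset.mem_powerset,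
      Finset.mem_powersetCard]
    refine ⟨I, ⟨hI.trans Finset.inter_subset_right, hIc⟩, S \ I,
      ⟨Finset.sdiff_subset_sdiff (Finset.subset_univ _) subset_rfl, ?_⟩,
      Finset.sdiff_union_of_subset hIS⟩
    rw [Finset.card_sdiff_of_subset hIS, hIc]
    omega
  have h1 : (univ.filter fun S : Finset (Fin m) => S.card ≤ r ∧ s ≤ (S ∩ J).card).card ≤
      J.card.choose s * binomLe (m - s) (r - s) := by
    refine (Finset.card_le_card hsub).trans (Finset.card_biUnion_le.trans ?_)
    rw [← Finset.card_powersetCard, ← smul_eq_mul]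
    refine Finset.sum_le_card_nsmul _ _ _ fun I hI => Finset.card_image_le.trans ?_
    rw [card_powerset_filter_card_le, Finset.card_sdiff_of_subset (Finset.subset_univ _),
      (Finset.mem_powersetCard.1 hI).2, Finset.card_univ, Fintype.card_fin]
  calc _ ≤ ((J.card.choose s * binomLe (m - s) (r - s) : ℕ) : ℝ) := by exact_mod_cast h1
    _ ≤ _ := by
      push_cast
      have := binomLe_sub_le hθ0 hθ1 s m r hsr hsm hr
      gcongr

/-- The number of monomials of degree at most `r` that meet `J`. -/
lemma card_monomials_meeting_le {m : ℕ} {θ : ℝ} (hθ0 : 0 ≤ θ) (hθ1 : θ ≤ 1) (r : ℕ)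
    (J : Finset (Fin m)) (hr : (r : ℝ) ≤ θ * ((m : ℝ) - J.card)) :
    ((univ.filter fun S : Finset (Fin m) => S.card ≤ r ∧ 1 ≤ (S ∩ J).card).card : ℝ) ≤
      (1 - (1 - θ) ^ J.card) * binomLe m r := by
  have hJ : J.card ≤ m := by simpa using Finset.card_le_univ J
  have h1 := le_binomLe_sub hθ0 hθ1 r J.card m hJ hr
  have h2 : (univ.filter fun S : Finset (Fin m) => S.card ≤ r ∧ 1 ≤ (S ∩ J).card).card +
      binomLe (m - J.card) r = binomLe m r := by
    have h3 : m - J.card = (univ \ J).card := by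
      rw [Finset.card_sdiff_of_subset (Finset.subset_univ _), Finset.card_univ, Fintype.card_fin]
    rw [h3, ← card_powerset_filter_card_le, ← card_filter_card_le,
      ← Finset.card_union_of_disjoint]
    · congr 1
      ext S
      have h4 : S ⊆ univ \ J ↔ ¬ 1 ≤ (S ∩ J).card := by
        rw [not_le, Nat.lt_one_iff, Finset.card_eq_zero, ← Finset.disjoint_iff_inter_eq_empty,
          Finset.subset_sdiff]
        simp
      simp only [Finset.mem_union, Finset.mem_filter, Finset.mem_univ, true_and,
        Finset.mem_powerset, h4]
      tauto
    · rw [Finset.disjoint_left]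
      intro S hS hS'
      simp only [Finset.mem_filter, Finset.mem_univ, true_and, Finset.mem_powerset] at hS hS'
      have h5 : S ∩ J = ∅ := by
        rw [← Finset.disjoint_iff_inter_eq_empty]
        exact (Finset.subset_sdiff.1 hS'.1).2
      rw [h5] at hS
      simp at hS
  have h3 : ((univ.filter fun S : Finset (Fin m) => S.card ≤ r ∧ 1 ≤ (S ∩ J).card).card : ℝ) +
      binomLe (m - J.card) r = binomLe m r := by exact_mod_cast h2
  linarith

section

/-! ### Weight distribution -/

variable {m r : ℕ}

lemma two_pow_le_card_nz {f : BF m} (hf : f ∈ RM m r) (hf0 : f ≠ 0) :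
    2 ^ m ≤ 2 ^ r * (nz f).card := by
  obtain ⟨c, hc⟩ := RM_repr hf
  have hmem : f ∈ monoSpan {S : Finset (Fin m) | (S ∩ univ).card ≤ r} := by
    rw [hc]
    refine Submodule.sum_mem _ fun S hS => Submodule.smul_mem _ _ (Submodule.subset_span ⟨S, ?_, rfl⟩)
    simpa using hS
  obtain ⟨z, hz⟩ := Function.ne_iff.1 hf0
  have h := two_pow_le_card_subCube univ r f hmem z hz
  rw [Finset.card_univ, Fintype.card_fin] at h
  refine h.trans (Nat.mul_le_mul_left _ ?_)
  refine Finset.card_le_card_of_injOn (fun u => z + u) ?_ fun a _ b _ hab => add_left_cancel hab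
  intro u hu
  simp only [Finset.coe_filter, Set.mem_ofPred_eq] at hu
  simp [nz, hu.2]

lemma natCast_le_two_rpow {A B D : ℕ} {e d : ℝ} (h : A ≤ 2 ^ m * (B * 2 ^ D))
    (hB : (B : ℝ) ≤ 2 ^ e) (hD : (D : ℝ) ≤ d) : (A : ℝ) ≤ 2 ^ (m + e + d) := by
  have h1 : (A : ℝ) ≤ 2 ^ m * (B * 2 ^ D) := by exact_mod_cast h
  rw [Real.rpow_add (by norm_num), Real.rpow_add (by norm_num), Real.rpow_natCast, mul_assoc]
  refine h1.trans ?_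
  gcongr
  rw [← Real.rpow_natCast]
  exact Real.rpow_le_rpow_of_exponent_le (by norm_num) hD

lemma choose_le_four_pow (s : ℕ) : (2 * s + 4).choose s ≤ 4 ^ (s + 1) := by
  rw [← Nat.sum_range_choose_halfway]
  rcases s with _ | s
  · simp [Finset.sum_range_succ]
  · rw [show 2 * (s + 1) + 4 = (2 * (s + 1 + 1) + 1) + 1 by ring, Nat.choose_succ_succ]
    have h : ({s, s + 1} : Finset ℕ) ⊆ Finset.range (s + 1 + 1 + 1) := by
      intro i hi
      simp only [Finset.mem_insert, Finset.mem_singleton] at hi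
      rw [Finset.mem_range]
      omega
    have := Finset.sum_le_sum_of_subset (f := fun i => (2 * (s + 1 + 1) + 1).choose i) h
    rwa [Finset.sum_pair (by omega)] at this

lemma exists_card_eq {t : ℕ} (h : t ≤ m) : ∃ J : Finset (Fin m), J.card = t := by
  obtain ⟨J, -, hJ⟩ := Finset.exists_subset_card_eq (s := (univ : Finset (Fin m)))
    (n := t) (by simpa using h)
  exact ⟨J, hJ⟩

/-- The number of codewords of weight at most `2^{-ℓ}`, for `ℓ = s + 1 ≥ 3`. -/
lemma card_lowW_two_pow_le (hm : m ≠ 0) (hr : (r : ℝ) ≤ 1 / 69 * m) (hrm : 2 * r + 4 ≤ m)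
    (j : ℕ) : ∀ s, 2 ≤ s → s + j = r → ((lowW m r (1 / 2 ^ (s + 1))).card : ℝ) ≤
      2 ^ (5 * (1 / 17 : ℝ) ^ s * binomLe m r + m * j) := by
  induction j with
  | zero =>
    intro s _ hs
    have hsub : lowW m r (1 / 2 ^ (s + 1)) ⊆ {0} := by
      intro f hf
      obtain ⟨hfR, hfw⟩ := mem_lowW.1 hf
      rw [Finset.mem_singleton]
      by_contra hf0
      have h1 : (2 : ℝ) ^ m ≤ 2 ^ r * (nz f).card := by
        exact_mod_cast two_pow_le_card_nz hfR hf0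
      have h2 : (2 : ℝ) ^ r * (nz f).card ≤ 2 ^ r * (1 / 2 ^ (s + 1) * 2 ^ m) := by gcongr
      have h3 : (2 : ℝ) ^ r * (1 / 2 ^ (s + 1) * 2 ^ m) = 2 ^ m / 2 := by
        rw [← hs, add_zero, pow_succ]
        field_simp
      have h4 : (0 : ℝ) < 2 ^ m := by positivity
      linarith
    have h1 : ((lowW m r (1 / 2 ^ (s + 1))).card : ℝ) ≤ 1 := by
      exact_mod_cast Finset.card_le_card hsub
    refine h1.trans (Real.one_le_rpow (by norm_num) ?_)
    positivity
  | succ j ih =>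
    intro s hs2 hs
    obtain ⟨J, hJ⟩ := exists_card_eq (m := m) (t := 2 * s + 4) (by omega)
    have hpow : (0 : ℝ) < 2 ^ s := by positivity
    have hstep := card_lowW_le hm r s (by omega) J (1 / 2 ^ (s + 1)) (1 / 2 ^ (s + 1 + 1))
      (one_div_lt_one_div_of_lt hpow (pow_lt_pow_right₀ (by norm_num) (by omega))) (by
        rw [hJ]
        have h1 : (1 : ℝ) / 2 ^ (s + 1 + 1) * (2 ^ (2 * s + 4) * (1 / 2 ^ s - 1 / 2 ^ (s + 1)) ^ 2)
            = 2 * (1 / 2 ^ (s + 1)) := by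
          rw [show 2 * s + 4 = s + s + 4 by ring]
          simp only [pow_add]
          field_simp
          norm_num
        rw [h1]
        have h2 : (0 : ℝ) < 1 / 2 ^ (s + 1) := by positivity
        nlinarith)
    have hD := card_monomials_le (θ := 1 / 69) (by norm_num) (by norm_num) r s (by omega)
      (by omega) hr J
    rw [hJ] at hD
    have hfin := natCast_le_two_rpow hstep (ih (s + 1) (by omega) (by omega)) hD
    refine hfin.trans (Real.rpow_le_rpow_of_exponent_le (by norm_num) ?_)
    have hc : (((2 * s + 4).choose s : ℕ) : ℝ) ≤ 4 ^ (s + 1) := by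
      exact_mod_cast choose_le_four_pow s
    have hK : (0 : ℝ) ≤ binomLe m r := Nat.cast_nonneg _
    have h4 : (4 : ℝ) ^ s * (1 / 69) ^ s ≤ (1 / 17) ^ s := by
      rw [← mul_pow]
      exact pow_le_pow_left₀ (by norm_num) (by norm_num) s
    have h5 : ((2 * s + 4).choose s : ℝ) * ((1 / 69) ^ s * binomLe m r) ≤
        4 * (1 / 17) ^ s * binomLe m r := by
      calc ((2 * s + 4).choose s : ℝ) * ((1 / 69) ^ s * binomLe m r)
          ≤ 4 ^ (s + 1) * ((1 / 69) ^ s * binomLe m r) := by gcongr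
        _ = 4 * (4 ^ s * (1 / 69) ^ s) * binomLe m r := by ring
        _ ≤ _ := by gcongr
    have h6 : (0 : ℝ) ≤ (1 / 17) ^ s * binomLe m r := by positivity
    push_cast
    rw [pow_succ]
    linarith

/-- The number of codewords of weight at most `2^{-ℓ}`, in the form used by the union bound. -/
lemma card_lowW_le_half_weight (hm : m ≠ 0) (hr : (r : ℝ) ≤ 1 / 69 * m) (hrm : 2 * r + 6 ≤ m)
    (ℓ : ℕ) (hℓ : 2 ≤ ℓ) (hℓr : ℓ ≤ r) : ((lowW m r (1 / 2 ^ ℓ)).card : ℝ) ≤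
      2 ^ (1 / 2 ^ (ℓ + 1) * (binomLe m r : ℝ) + m * (r + 2)) := by
  have hK : (0 : ℝ) ≤ binomLe m r := Nat.cast_nonneg _
  have hm0 : (0 : ℝ) ≤ m := Nat.cast_nonneg _
  rcases hℓ.eq_or_lt with rfl | hℓ
  · obtain ⟨J, hJ⟩ := exists_card_eq (m := m) (t := 6) (by omega)
    have hstep := card_lowW_le hm r 1 le_rfl J (1 / 2 ^ 2) (1 / 2 ^ 3) (by norm_num)
      (by rw [hJ]; norm_num)
    have hD := card_monomials_le (θ := 1 / 69) (by norm_num) (by norm_num) r 1 (by omega)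
      (by omega) hr J
    rw [hJ] at hD
    have hfin := natCast_le_two_rpow hstep
      (card_lowW_two_pow_le hm hr (by omega) (r - 2) 2 le_rfl (by omega)) hD
    refine hfin.trans (Real.rpow_le_rpow_of_exponent_le (by norm_num) ?_)
    have h1 : ((r - 2 : ℕ) : ℝ) ≤ r := by exact_mod_cast Nat.sub_le r 2
    have h2 : (m : ℝ) * (r - 2 : ℕ) ≤ m * r := by gcongr
    norm_num
    linarith
  · obtain ⟨s, rfl⟩ : ∃ s, ℓ = s + 1 := ⟨ℓ - 1, by omega⟩
    have hfin := card_lowW_two_pow_le hm hr (by omega) (r - s) s (by omega) (by omega)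
    refine hfin.trans (Real.rpow_le_rpow_of_exponent_le (by norm_num) ?_)
    have h1 : ((r - s : ℕ) : ℝ) ≤ r := by exact_mod_cast Nat.sub_le r s
    have h2 : (m : ℝ) * (r - s : ℕ) ≤ m * r := by gcongr
    have h3 : 5 * (1 / 17 : ℝ) ^ s ≤ 1 / 2 ^ (s + 1 + 1) := by
      obtain ⟨i, rfl⟩ : ∃ i, s = i + 2 := ⟨s - 2, by omega⟩
      have h4 : (1 / 17 : ℝ) ^ i ≤ (1 / 2) ^ i := pow_le_pow_left₀ (by norm_num) (by norm_num) i
      have h5 : (0 : ℝ) ≤ (1 / 2) ^ i := by positivity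
      have h6 : (1 : ℝ) / 2 ^ (i + 2 + 1 + 1) = (1 / 2) ^ i * (1 / 16) := by
        rw [← one_div_pow]; ring
      rw [h6, pow_add]
      linarith
    have h4 : 5 * (1 / 17 : ℝ) ^ s * binomLe m r ≤ 1 / 2 ^ (s + 1 + 1) * binomLe m r := by gcongr
    linarith

lemma bias_exponent_le (k : ℕ) (hk : 2 ≤ k) :
    1 - (1 - 1 / 69 : ℝ) ^ (3 * k + 3) + 5 * (1 / 17) ^ (k + 1) ≤
      (1 - 2 * (1 / 2) ^ k) / (1 + 2 * (1 / 2) ^ k) := by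
  have key : 2 * (2 * (1 / 2 : ℝ) ^ k) / (1 + 2 * (1 / 2) ^ k) + 5 * (1 / 17) ^ (k + 1) ≤
      (1 - 1 / 69 : ℝ) ^ (3 * k + 3) := by
    have h1 : (19 / 20 : ℝ) ^ (k + 1) ≤ (1 - 1 / 69 : ℝ) ^ (3 * k + 3) := by
      rw [show 3 * k + 3 = 3 * (k + 1) by ring, pow_mul]
      exact pow_le_pow_left₀ (by norm_num) (by norm_num) _
    refine le_trans ?_ h1
    rcases hk.eq_or_lt with rfl | hk
    · norm_num
    · obtain ⟨i, rfl⟩ : ∃ i, k = i + 3 := ⟨k - 3, by omega⟩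
      have h2 : (0 : ℝ) < (1 / 2) ^ (i + 3) := by positivity
      have h3 : 2 * (2 * (1 / 2 : ℝ) ^ (i + 3)) / (1 + 2 * (1 / 2) ^ (i + 3)) ≤
          2 * (2 * (1 / 2 : ℝ) ^ (i + 3)) := by
        rw [div_le_iff₀ (by positivity)]
        nlinarith
      have h4 : (1 / 17 : ℝ) ^ i ≤ (19 / 20) ^ i :=
        pow_le_pow_left₀ (by norm_num) (by norm_num) i
      have h5 : (1 / 2 : ℝ) ^ i ≤ (19 / 20) ^ i :=
        pow_le_pow_left₀ (by norm_num) (by norm_num) i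
      have h6 : (0 : ℝ) ≤ (19 / 20) ^ i := by positivity
      refine (add_le_add_left h3 _).trans ?_
      rw [show i + 3 + 1 = i + 4 by ring, pow_add, pow_add, pow_add]
      norm_num
      linarith
  have hpos : (0 : ℝ) < 1 + 2 * (1 / 2) ^ k := by positivity
  have h : (1 - 2 * (1 / 2 : ℝ) ^ k) / (1 + 2 * (1 / 2) ^ k) =
      1 - 2 * (2 * (1 / 2 : ℝ) ^ k) / (1 + 2 * (1 / 2) ^ k) := by
    field_simp
    ring
  rw [h]
  linarith

/-- The number of codewords of bias at least `2^{-k}`. -/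
lemma card_lowW_bias_le (hm : m ≠ 0) (k : ℕ) (hk : 2 ≤ k) (hkr : k + 1 ≤ r)
    (hr : (r : ℝ) ≤ 1 / 69 * ((m : ℝ) - (3 * k + 3))) (hrm : 2 * r + 4 ≤ m) (hkm : 3 * k + 3 ≤ m) :
    ((lowW m r ((1 - (1 / 2) ^ k) / 2)).card : ℝ) ≤
      2 ^ ((1 - 2 * (1 / 2) ^ k) / (1 + 2 * (1 / 2) ^ k) * (binomLe m r : ℝ) + m * (r + 2)) := by
  have hK : (0 : ℝ) ≤ binomLe m r := Nat.cast_nonneg _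
  have hm0 : (0 : ℝ) ≤ m := Nat.cast_nonneg _
  obtain ⟨J, hJ⟩ := exists_card_eq hkm
  have hx : (0 : ℝ) < (1 / 2) ^ k := by positivity
  have hstep := card_lowW_le hm r 1 le_rfl J ((1 - (1 / 2) ^ k) / 2) (1 / 2 ^ (k + 1 + 1))
    (by linarith) (by
      have h1 : (1 : ℝ) / 2 ^ (k + 1 + 1) *
          (2 ^ (3 * k + 3) * (1 / 2 ^ 1 - (1 - (1 / 2) ^ k) / 2) ^ 2) = 1 / 2 := by
        rw [show 3 * k + 3 = k + k + k + 3 by ring, one_div_pow]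
        simp only [pow_add]
        field_simp
        ring
      rw [hJ, h1]
      nlinarith)
  have hD := card_monomials_meeting_le (θ := 1 / 69) (by norm_num) (by norm_num) r J
    (by rw [hJ]; push_cast; exact hr)
  rw [hJ] at hD
  have hfin := natCast_le_two_rpow hstep
    (card_lowW_two_pow_le hm (by linarith [(Nat.cast_nonneg k : (0 : ℝ) ≤ k)]) hrm
      (r - (k + 1)) (k + 1) (by omega) (by omega)) hD
  refine hfin.trans (Real.rpow_le_rpow_of_exponent_le (by norm_num) ?_)
  have h1 : ((r - (k + 1) : ℕ) : ℝ) ≤ r := by exact_mod_cast Nat.sub_le r (k + 1)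
  have h2 : (m : ℝ) * (r - (k + 1) : ℕ) ≤ m * r := by gcongr
  have h3 := mul_le_mul_of_nonneg_right (bias_exponent_le k hk) hK
  linarith

lemma card_RM_le : ((univ.filter fun f : BF m => f ∈ RM m r).card : ℝ) ≤ 2 ^ (binomLe m r : ℝ) := by
  rw [Real.rpow_natCast]
  set D := univ.filter fun S : Finset (Fin m) => S.card ≤ r with hD
  have hsub : (univ.filter fun f : BF m => f ∈ RM m r) ⊆
      (univ : Finset (D → ZMod 2)).image fun c => ∑ S : D, c S • monoFn S.1 := by
    intro f hf
    obtain ⟨c, hc⟩ := RM_repr (Finset.mem_filter.1 hf).2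
    refine Finset.mem_image.2 ⟨fun S => c S, Finset.mem_univ _, ?_⟩
    rw [hc]
    exact Finset.sum_coe_sort D fun S => c S • monoFn S
  have h1 := (Finset.card_le_card hsub).trans Finset.card_image_le
  rw [Finset.card_univ, Fintype.card_fun, Fintype.card_coe, hD, card_filter_card_le, ZMod.card] at h1
  exact_mod_cast h1

end

section

/-! ### Error probabilities on the binary symmetric channel -/

variable {m r : ℕ}

/-- The sign `(-1)^a`. -/
noncomputable def zsign (a : ZMod 2) : ℝ := if a = 0 then 1 else -1

/-- Probability of the error vector `v` on the binary symmetric channel. -/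
noncomputable def bscProb (p : ℝ) (v : BF m) : ℝ := ∏ x, if v x = 0 then 1 - p else p

lemma sum_zmod_two (g : ZMod 2 → ℝ) : ∑ a, g a = g 0 + g 1 := by
  have h : (univ : Finset (ZMod 2)) = {0, 1} := by decide
  rw [h, Finset.sum_pair (by decide)]

lemma sum_prod_eq_prod_add (g : Cube m → ZMod 2 → ℝ) :
    ∑ v : BF m, ∏ x, g x (v x) = ∏ x, (g x 0 + g x 1) := by
  simp_rw [← sum_zmod_two]
  rw [Finset.prod_univ_sum, Fintype.piFinset_univ]

lemma bscProb_eq (p : ℝ) (v : BF m) :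
    bscProb p v = p ^ hammingNorm v * (1 - p) ^ (2 ^ m - hammingNorm v) := by
  have hc : (univ.filter fun x => v x = 0).card = 2 ^ m - hammingNorm v := by
    have h := Finset.card_filter_add_card_filter_not (s := (univ : Finset (Cube m)))
      (fun x => v x = 0)
    have h2 : (univ : Finset (Cube m)).card = 2 ^ m := by simp [ZMod.card]
    have h3 : hammingNorm v = (univ.filter fun x => ¬ v x = 0).card := by
      simp only [hammingNorm]
    omega
  rw [bscProb, Finset.prod_ite, Finset.prod_const, Finset.prod_const, hc, mul_comm]
  congr 2

lemma bscProb_nonneg {p : ℝ} (h0 : 0 ≤ p) (h1 : p ≤ 1) (v : BF m) : 0 ≤ bscProb p v :=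
  Finset.prod_nonneg fun x _ => by split_ifs <;> linarith

lemma sum_bscProb_mul_exp (p : ℝ) (c : Cube m → ℝ) :
    ∑ v : BF m, bscProb p v * Real.exp (∑ x, c x * zsign (v x)) =
      ∏ x, ((1 - p) * Real.exp (c x) + p * Real.exp (-c x)) := by
  have h := sum_prod_eq_prod_add fun x (a : ZMod 2) =>
    (if a = 0 then 1 - p else p) * Real.exp (c x * zsign a)
  simp only [Finset.prod_mul_distrib, ← Real.exp_sum] at h
  simp only [bscProb, h]
  refine Finset.prod_congr rfl fun x _ => ?_
  simp [zsign]

lemma sum_zsign (v : BF m) : ∑ x, zsign (v x) = 2 ^ m - 2 * (hammingNorm v : ℝ) := by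
  have h : ∀ x, zsign (v x) = 1 - 2 * (if v x ≠ 0 then (1 : ℝ) else 0) := fun x => by
    by_cases hx : v x = 0 <;> simp [zsign, hx]; norm_num
  simp_rw [h]
  rw [Finset.sum_sub_distrib, ← Finset.mul_sum, Finset.sum_boole]
  simp only [hammingNorm, Finset.sum_const, Finset.card_univ, Fintype.card_pi, ZMod.card,
    Finset.prod_const, Fintype.card_fin]
  simp

lemma zsign_add (a b : ZMod 2) : zsign (a + b) = zsign a * zsign b := by
  by_cases ha : a = 0 <;> by_cases hb : b = 0
  · simp [zsign, ha, hb]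
  · simp [zsign, ha, hb]
  · simp [zsign, ha, hb]
  · have h : (1 : ZMod 2) + 1 = 0 := by decide
    simp [zsign, zmod_two_eq_one ha, zmod_two_eq_one hb, h]

lemma sum_zsign_nz_nonpos {v f : BF m} (h : hammingNorm (v + f) ≤ hammingNorm v) :
    ∑ x ∈ nz f, zsign (v x) ≤ 0 := by
  have h1 := sum_zsign v
  have h2 := sum_zsign (v + f)
  have h3 : ∑ x, zsign (v x) - ∑ x, zsign ((v + f) x) = 2 * ∑ x ∈ nz f, zsign (v x) := by
    rw [← Finset.sum_sub_distrib, nz, Finset.sum_filter, Finset.mul_sum]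
    refine Finset.sum_congr rfl fun x _ => ?_
    rw [Pi.add_apply, zsign_add]
    by_cases hx : f x = 0 <;> simp [zsign, hx]
    split_ifs <;> norm_num
  have h4 : (hammingNorm (v + f) : ℝ) ≤ hammingNorm v := by exact_mod_cast h
  linarith

lemma sinh_le_mul_cosh {x : ℝ} (hx : 0 ≤ x) : Real.sinh x ≤ x * Real.cosh x := by
  have hd : ∀ y : ℝ, HasDerivAt (fun y => y * Real.cosh y - Real.sinh y) (y * Real.sinh y) y :=
    fun y => by
      have := ((hasDerivAt_id y).mul (Real.hasDerivAt_cosh y)).sub (Real.hasDerivAt_sinh y)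
      convert! this using 1
      simp
  have hmono : MonotoneOn (fun y => y * Real.cosh y - Real.sinh y) (Set.Ici 0) := by
    refine monotoneOn_of_deriv_nonneg (convex_Ici 0)
      (fun y _ => (hd y).continuousAt.continuousWithinAt)
      (fun y _ => (hd y).differentiableAt.differentiableWithinAt) fun y hy => ?_
    rw [interior_Ici] at hy
    rw [(hd y).deriv]
    exact mul_nonneg hy.le (Real.sinh_nonneg_iff.2 hy.le)
  have := hmono (Set.self_mem_Ici) hx hx
  simp at this
  linarith

lemma mgf_le {p l : ℝ} (hp : p ≤ 1 / 2) (hl : 0 ≤ l) :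
    (1 - p) * Real.exp l + p * Real.exp (-l) ≤
      Real.exp (l ^ 2 / 2 + (1 - 2 * p) * l) := by
  have h1 : (1 - p) * Real.exp l + p * Real.exp (-l) =
      Real.cosh l + (1 - 2 * p) * Real.sinh l := by
    rw [Real.cosh_eq, Real.sinh_eq]; ring
  have hc := (Real.cosh_pos l).le
  calc (1 - p) * Real.exp l + p * Real.exp (-l)
      = Real.cosh l + (1 - 2 * p) * Real.sinh l := h1
    _ ≤ Real.cosh l + (1 - 2 * p) * (l * Real.cosh l) := by
        gcongr
        · linarith
        · exact sinh_le_mul_cosh hl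
    _ = Real.cosh l * ((1 - 2 * p) * l + 1) := by ring
    _ ≤ Real.exp (l ^ 2 / 2) * Real.exp ((1 - 2 * p) * l) := by
        have : 0 ≤ (1 - 2 * p) * l := mul_nonneg (by linarith) hl
        gcongr
        · exact Real.cosh_le_exp_half_sq l
        · exact Real.add_one_le_exp _
    _ = _ := by rw [← Real.exp_add]

lemma mgf_neg_le {p l : ℝ} (hp0 : 0 ≤ p) (hp : p ≤ 1) (hl : 0 ≤ l) (hl1 : l ≤ 1) :
    (1 - p) * Real.exp (-l) + p * Real.exp l ≤ Real.exp (-((1 - 2 * p) * l) + l ^ 2) := by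
  have h1 := (abs_le.1 (Real.abs_exp_sub_one_sub_id_le (x := l) (by rwa [abs_of_nonneg hl]))).2
  have h2 := (abs_le.1 (Real.abs_exp_sub_one_sub_id_le (x := -l)
    (by rwa [abs_neg, abs_of_nonneg hl]))).2
  have h3 := Real.add_one_le_exp (-((1 - 2 * p) * l) + l ^ 2)
  have h4 := mul_le_mul_of_nonneg_left h1 hp0
  have h5 := mul_le_mul_of_nonneg_left h2 (sub_nonneg.2 hp)
  nlinarith

lemma exists_mgf_le {p : ℝ} (hp0 : 0 < p) (hp : p < 1 / 2) :
    ∃ l : ℝ, 0 ≤ l ∧ (1 - p) * Real.exp (-l) + p * Real.exp l ≤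
      Real.exp (-((1 - 2 * p) ^ 2 / 2)) := by
  set s := √((1 - p) / p) with hs
  have hq : 1 ≤ (1 - p) / p := by rw [le_div_iff₀ hp0]; linarith
  have hs1 : 1 ≤ s := Real.one_le_sqrt.2 hq
  have hss : s ^ 2 * p = 1 - p := by
    rw [hs, Real.sq_sqrt (by linarith)]; field_simp
  refine ⟨Real.log s, Real.log_nonneg hs1, ?_⟩
  have hs0 : 0 < s := by linarith
  rw [Real.exp_neg, Real.exp_log hs0]
  have h1 : (1 - p) * s⁻¹ + p * s = 2 * p * s := by
    rw [← hss]; field_simp; ring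
  rw [h1]
  refine le_of_sq_le_sq ?_ (Real.exp_pos _).le
  rw [← Real.exp_nat_mul]
  have h2 := Real.add_one_le_exp (-(1 - 2 * p) ^ 2)
  have h3 : (2 * p * s) ^ 2 = -(1 - 2 * p) ^ 2 + 1 := by
    linear_combination 4 * p * hss
  rw [h3]
  convert! h2 using 2
  push_cast; ring

/-- Typical error vectors: those with few errors, up to a relative slack `κ`. -/
noncomputable def IsTypical (p κ : ℝ) (v : BF m) : Prop :=
  (1 - κ) * (1 - 2 * p) * 2 ^ m ≤ ∑ x, zsign (v x)

lemma sum_bscProb_not_typical_le {p κ : ℝ} (hp0 : 0 < p) (hp : p < 1 / 2) (hκ : 0 ≤ κ)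
    (hκ1 : κ ≤ 1) :
    ∑ v : BF m with ¬ IsTypical p κ v, bscProb p v ≤
      Real.exp (-(κ ^ 2 * (1 - 2 * p) ^ 2 * 2 ^ m / 4)) := by
  set μ := 1 - 2 * p with hμ
  have hμ0 : 0 ≤ μ := by linarith
  set l := κ * μ / 2 with hl
  have hl0 : 0 ≤ l := by positivity
  have hl1 : l ≤ 1 := by nlinarith
  have hcard : (univ : Finset (Cube m)).card = 2 ^ m := by simp [ZMod.card]
  calc ∑ v : BF m with ¬ IsTypical p κ v, bscProb p v
      ≤ ∑ v : BF m with ¬ IsTypical p κ v, bscProb p v *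
          Real.exp ((∑ x, -l * zsign (v x)) + l * ((1 - κ) * μ * 2 ^ m)) := by
        refine Finset.sum_le_sum fun v hv => le_mul_of_one_le_right
          (bscProb_nonneg hp0.le (by linarith) v) (Real.one_le_exp ?_)
        have := (Finset.mem_filter.1 hv).2
        rw [IsTypical, not_le] at this
        rw [← Finset.mul_sum]
        nlinarith
    _ ≤ ∑ v : BF m, bscProb p v *
          Real.exp ((∑ x, -l * zsign (v x)) + l * ((1 - κ) * μ * 2 ^ m)) :=
        Finset.sum_le_sum_of_subset_of_nonneg (Finset.filter_subset _ _) fun v _ _ =>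
          mul_nonneg (bscProb_nonneg hp0.le (by linarith) v) (Real.exp_pos _).le
    _ = (∏ x : Cube m, ((1 - p) * Real.exp (-l) + p * Real.exp (- -l))) *
          Real.exp (l * ((1 - κ) * μ * 2 ^ m)) := by
        rw [← sum_bscProb_mul_exp, Finset.sum_mul]
        simp_rw [Real.exp_add, mul_assoc]
    _ ≤ (∏ x : Cube m, Real.exp (-(μ * l) + l ^ 2)) *
          Real.exp (l * ((1 - κ) * μ * 2 ^ m)) := by
        gcongr with x
        · intro x _
          have : 0 ≤ 1 - p := by linarith
          positivity
        · rw [neg_neg]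
          exact mgf_neg_le hp0.le (by linarith) hl0 hl1
    _ = _ := by
        rw [Finset.prod_const, hcard, ← Real.exp_nat_mul, ← Real.exp_add]
        congr 1
        push_cast
        rw [hl]; ring

lemma sum_bscProb_confused_le {p κ ρ : ℝ} (hp0 : 0 < p) (hp : p < 1 / 2) (hρ : 0 ≤ ρ)
    (f : BF m) (hf : ρ * 2 ^ m ≤ (1 + ρ) * (nz f).card) :
    ∑ v : BF m with IsTypical p κ v ∧ hammingNorm (v + f) ≤ hammingNorm v, bscProb p v ≤
      Real.exp (-((1 - 2 * p) ^ 2 * 2 ^ m / 2 * (1 - 2 * κ) * ρ)) := by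
  set μ := 1 - 2 * p with hμ
  have hμ0 : 0 ≤ μ := by linarith
  have hcard : (univ : Finset (Cube m)).card = 2 ^ m := by simp [ZMod.card]
  obtain ⟨l, hl0, hl⟩ := exists_mgf_le hp0 hp
  set t := μ * ρ with ht
  have ht0 : 0 ≤ t := by positivity
  set c : Cube m → ℝ := fun x => if f x ≠ 0 then -l else t with hc
  have hcsum : ∀ v : BF m, ∑ x, c x * zsign (v x) =
      -l * ∑ x ∈ nz f, zsign (v x) + t * (∑ x, zsign (v x) - ∑ x ∈ nz f, zsign (v x)) := by
    intro v
    rw [nz, Finset.sum_filter, ← Finset.sum_sub_distrib, Finset.mul_sum, Finset.mul_sum,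
      ← Finset.sum_add_distrib]
    refine Finset.sum_congr rfl fun x _ => ?_
    by_cases hx : f x = 0 <;> simp [hc, hx]
  have hprod : ∏ x, ((1 - p) * Real.exp (c x) + p * Real.exp (-c x)) ≤
      Real.exp (((nz f).card : ℝ) * (-(μ ^ 2 / 2)) +
        ((2 : ℝ) ^ m - (nz f).card) * (t ^ 2 / 2 + μ * t)) := by
    have h1 : ∀ x, (1 - p) * Real.exp (c x) + p * Real.exp (-c x) ≤
        Real.exp (if f x ≠ 0 then -(μ ^ 2 / 2) else t ^ 2 / 2 + μ * t) := by
      intro x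
      by_cases hx : f x = 0
      · simpa [hc, hx] using mgf_le hp.le ht0
      · simpa [hc, hx] using hl
    refine (Finset.prod_le_prod (fun x _ => ?_) fun x _ => h1 x).trans_eq ?_
    · have : 0 ≤ 1 - p := by linarith
      positivity
    rw [← Real.exp_sum]
    congr 1
    have h2 : ((univ.filter fun x => ¬ f x ≠ 0).card : ℝ) = 2 ^ m - (nz f).card := by
      have := Finset.card_filter_add_card_filter_not (s := (univ : Finset (Cube m)))
        (fun x => f x ≠ 0)
      rw [hcard] at this
      rw [eq_sub_iff_add_eq', nz]
      exact_mod_cast this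
    rw [Finset.sum_ite, Finset.sum_const, Finset.sum_const, nsmul_eq_mul, nsmul_eq_mul, h2, nz]
  calc ∑ v : BF m with IsTypical p κ v ∧ hammingNorm (v + f) ≤ hammingNorm v, bscProb p v
      ≤ ∑ v : BF m with IsTypical p κ v ∧ hammingNorm (v + f) ≤ hammingNorm v, bscProb p v *
          Real.exp ((∑ x, c x * zsign (v x)) + -(t * ((1 - κ) * μ * 2 ^ m))) := by
        refine Finset.sum_le_sum fun v hv => le_mul_of_one_le_right
          (bscProb_nonneg hp0.le (by linarith) v) (Real.one_le_exp ?_)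
        obtain ⟨h1, h2⟩ := (Finset.mem_filter.1 hv).2
        have h3 := sum_zsign_nz_nonpos h2
        rw [IsTypical] at h1
        rw [hcsum]
        nlinarith [mul_nonneg hl0 (neg_nonneg.2 h3), mul_nonneg ht0 (neg_nonneg.2 h3),
          mul_nonneg ht0 (sub_nonneg.2 h1)]
    _ ≤ ∑ v : BF m, bscProb p v *
          Real.exp ((∑ x, c x * zsign (v x)) + -(t * ((1 - κ) * μ * 2 ^ m))) :=
        Finset.sum_le_sum_of_subset_of_nonneg (Finset.filter_subset _ _) fun v _ _ =>
          mul_nonneg (bscProb_nonneg hp0.le (by linarith) v) (Real.exp_pos _).le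
    _ = (∏ x, ((1 - p) * Real.exp (c x) + p * Real.exp (-c x))) *
          Real.exp (-(t * ((1 - κ) * μ * 2 ^ m))) := by
        rw [← sum_bscProb_mul_exp, Finset.sum_mul]
        simp_rw [Real.exp_add, mul_assoc]
    _ ≤ Real.exp (((nz f).card : ℝ) * (-(μ ^ 2 / 2)) +
          ((2 : ℝ) ^ m - (nz f).card) * (t ^ 2 / 2 + μ * t)) *
          Real.exp (-(t * ((1 - κ) * μ * 2 ^ m))) := by
        gcongr
    _ ≤ _ := by
        rw [← Real.exp_add]
        refine Real.exp_le_exp.2 ?_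
        have h1 : 0 ≤ μ ^ 2 / 2 * (1 + ρ) := by positivity
        have h2 := mul_le_mul_of_nonneg_left hf h1
        rw [ht]
        nlinarith

/-- Union bound over classes of codewords `c.1` whose weights are at least `ρ / (1 + ρ)`,
where `ρ = c.2`. -/
lemma bscFailProb_le {p κ : ℝ} (hp0 : 0 < p) (hp : p < 1 / 2) (hκ : 0 ≤ κ) (hκ1 : κ ≤ 1)
    (J : Finset (Finset (BF m) × ℝ)) (hcov : ∀ f ∈ RM m r, f ≠ 0 → ∃ c ∈ J, f ∈ c.1)
    (hρ : ∀ c ∈ J, 0 ≤ c.2)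
    (hJ : ∀ c ∈ J, ∀ f ∈ c.1, c.2 * 2 ^ m ≤ (1 + c.2) * (nz f).card) :
    bscFailProb m r p ≤ Real.exp (-(κ ^ 2 * (1 - 2 * p) ^ 2 * 2 ^ m / 4)) +
      ∑ c ∈ J, (c.1.card : ℝ) *
        Real.exp (-((1 - 2 * p) ^ 2 * 2 ^ m / 2 * (1 - 2 * κ) * c.2)) := by
  have hnn : ∀ v : BF m, 0 ≤ bscProb p v := bscProb_nonneg hp0.le (by linarith)
  have h1 : bscFailProb m r p ≤ ∑ v : BF m with ¬ IsTypical p κ v, bscProb p v +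
      ∑ c ∈ J, ∑ f ∈ c.1, ∑ v : BF m with IsTypical p κ v ∧
        hammingNorm (v + f) ≤ hammingNorm v, bscProb p v := by
    simp_rw [Finset.sum_filter]
    have hswap : ∑ c ∈ J, ∑ f ∈ c.1, ∑ v : BF m, (if IsTypical p κ v ∧
        hammingNorm (v + f) ≤ hammingNorm v then bscProb p v else 0) =
        ∑ v : BF m, ∑ c ∈ J, ∑ f ∈ c.1, (if IsTypical p κ v ∧
        hammingNorm (v + f) ≤ hammingNorm v then bscProb p v else 0) := by
      symm
      rw [Finset.sum_comm]
      exact Finset.sum_congr rfl fun c _ => Finset.sum_comm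
    rw [hswap, ← Finset.sum_add_distrib, bscFailProb]
    refine Finset.sum_le_sum fun v _ => ?_
    rw [← bscProb_eq]
    have hS : ∀ c ∈ J, ∀ f ∈ c.1, 0 ≤ (if IsTypical p κ v ∧
        hammingNorm (v + f) ≤ hammingNorm v then bscProb p v else 0) := fun c _ f _ => by
      split_ifs
      · exact hnn v
      · exact le_rfl
    have hS' : ∀ c ∈ J, 0 ≤ ∑ f ∈ c.1, (if IsTypical p κ v ∧
        hammingNorm (v + f) ≤ hammingNorm v then bscProb p v else 0) :=
      fun c hc => Finset.sum_nonneg (hS c hc)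
    by_cases hE : ∃ f ∈ RM m r, f ≠ 0 ∧ hammingNorm (v + f) ≤ hammingNorm v
    · rw [if_pos hE, mul_one]
      by_cases hT : IsTypical p κ v
      · obtain ⟨f, hf, hf0, hfv⟩ := hE
        obtain ⟨c, hc, hfc⟩ := hcov f hf hf0
        rw [if_neg (not_not.2 hT), zero_add]
        refine le_trans ?_ (Finset.single_le_sum hS' hc)
        refine le_trans ?_ (Finset.single_le_sum (hS c hc) hfc)
        rw [if_pos ⟨hT, hfv⟩]
      · rw [if_pos hT]
        exact le_add_of_nonneg_right (Finset.sum_nonneg hS')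
    · rw [if_neg hE, mul_zero]
      refine add_nonneg ?_ (Finset.sum_nonneg hS')
      split_ifs
      · exact le_rfl
      · exact hnn v
  refine h1.trans (add_le_add (sum_bscProb_not_typical_le hp0 hp hκ hκ1)
    (Finset.sum_le_sum fun c hc => ?_))
  rw [← nsmul_eq_mul]
  exact Finset.sum_le_card_nsmul _ _ _ fun f hf =>
    sum_bscProb_confused_le hp0 hp (hρ c hc) f (hJ c hc f hf)

end

/-! ### Entropy near one half -/

lemma binH_eq (p : ℝ) : binH p = Real.binEntropy p / Real.log 2 := by
  simp only [binH, Real.binEntropy, Real.logb, Real.log_inv]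
  ring

lemma log_two_sub_binEntropy_le {p : ℝ} (hp0 : 1 / 4 ≤ p) (hp : p ≤ 1 / 2) :
    Real.log 2 - Real.binEntropy p ≤ (1 - 2 * p) ^ 2 / 2 * (1 + 4 * (1 - 2 * p)) := by
  obtain ⟨μ, rfl⟩ : ∃ μ, p = (1 - μ) / 2 := ⟨1 - 2 * p, by ring⟩
  have hμ0 : 0 ≤ μ := by linarith
  have hμ1 : μ ≤ 1 / 2 := by linarith
  have h1 := (abs_le.1 (Real.abs_log_sub_add_sum_range_le (x := μ)
    (by rw [abs_of_nonneg hμ0]; linarith) 2)).2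
  have h2 := (abs_le.1 (Real.abs_log_sub_add_sum_range_le (x := -μ)
    (by rw [abs_neg, abs_of_nonneg hμ0]; linarith) 2)).2
  rw [abs_neg] at h2
  rw [abs_of_nonneg hμ0] at h1 h2
  have h3 : μ ^ (2 + 1) / (1 - μ) ≤ 2 * μ ^ 3 := by
    rw [div_le_iff₀ (by linarith)]
    have := mul_nonneg (pow_nonneg hμ0 3) (sub_nonneg.2 hμ1)
    norm_num
    linarith
  simp only [Finset.sum_range_succ, Finset.sum_range_zero] at h1 h2
  norm_num at h1 h2 h3
  have e1 : Real.log ((1 - μ) / 2) = Real.log (1 - μ) - Real.log 2 :=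
    Real.log_div (by linarith) (by norm_num)
  have e2 : Real.log (1 - (1 - μ) / 2) = Real.log (1 + μ) - Real.log 2 := by
    rw [← Real.log_div (by linarith) (by norm_num)]
    congr 1; ring
  rw [Real.binEntropy, Real.log_inv, Real.log_inv, e1, e2]
  have h4 : Real.log (1 - μ) ≤ 2 * μ ^ 3 - μ - μ ^ 2 / 2 := by linarith
  have h5 : Real.log (1 + μ) ≤ 2 * μ ^ 3 + μ - μ ^ 2 / 2 := by linarith
  have h6 := mul_le_mul_of_nonneg_left h4 (show 0 ≤ (1 - μ) / 2 by linarith)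
  have h7 := mul_le_mul_of_nonneg_left h5 (show 0 ≤ (1 + μ) / 2 by linarith)
  nlinarith

lemma exists_one_sub_binH_le {ε : ℝ} (hε : 0 < ε) : ∃ θ > 0, ∀ p ∈ Set.Ioo (0 : ℝ) (1 / 2),
    1 - θ < binH p → Real.log 2 * (1 - binH p) ≤ (1 + ε) * ((1 - 2 * p) ^ 2 / 2) := by
  have hl : 0 < Real.log 2 := Real.log_pos one_lt_two
  set μ := min (ε / 4) (1 / 2) with hμ
  have hμ0 : 0 < μ := lt_min (by linarith) (by norm_num)
  have hμ1 : μ ≤ 1 / 2 := min_le_right _ _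
  have hμ2 : μ ≤ ε / 4 := min_le_left _ _
  refine ⟨1 - binH ((1 - μ) / 2), ?_, fun p hp h => ?_⟩
  · rw [binH_eq, gt_iff_lt, sub_pos, div_lt_one hl, Real.binEntropy_lt_log_two]
    norm_num
    intro h
    linarith
  · rw [sub_sub_cancel, binH_eq, binH_eq, div_lt_div_iff_of_pos_right hl] at h
    have hlt : (1 - μ) / 2 < p := by
      refine (Real.binEntropy_strictMonoOn.lt_iff_lt ?_ ?_).1 h
      · constructor <;> linarith
      · constructor <;> linarith [hp.1, hp.2]
    have h1 := log_two_sub_binEntropy_le (p := p) (by linarith) hp.2.le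
    have h2 : Real.log 2 * (1 - binH p) = Real.log 2 - Real.binEntropy p := by
      rw [binH_eq]; field_simp
    rw [h2]
    refine h1.trans ?_
    rw [mul_comm]
    gcongr
    linarith

section

/-! ### Union bound over weight classes -/

variable {m r : ℕ}

/-- Codewords of weight at most `b`, whose weight is also at least `ρ / (1 + ρ)`. -/
noncomputable def weightClass (m r : ℕ) (b ρ : ℝ) : Finset (BF m) :=
  (lowW m r b).filter fun f => ρ * 2 ^ m ≤ (1 + ρ) * (nz f).card

lemma card_mul_exp_le {C K E ρ δ N T : ℝ} (hρ : 0 ≤ ρ)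
    (hE : (1 + δ / 4) * K * Real.log 2 ≤ E) (hC : C ≤ 2 ^ N)
    (hN : N - (1 + δ / 4) * K * ρ ≤ T) : C * Real.exp (-(E * ρ)) ≤ 2 ^ T := by
  calc C * Real.exp (-(E * ρ)) ≤ 2 ^ N * Real.exp (-((1 + δ / 4) * K * Real.log 2 * ρ)) := by
        gcongr
    _ = 2 ^ (N - (1 + δ / 4) * K * ρ) := by
        rw [sub_eq_add_neg, Real.rpow_add two_pos, Real.rpow_def_of_pos two_pos (-_)]
        congr 2; ring
    _ ≤ 2 ^ T := Real.rpow_le_rpow_of_exponent_le one_le_two hN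

lemma bscFailProb_le_of_capacity {p κ δ : ℝ} {k₀ : ℕ} (hp0 : 0 < p) (hp : p < 1 / 2)
    (hκ : 0 ≤ κ) (hκ1 : κ ≤ 1) (hδ : 0 < δ) (hk₀ : 2 ≤ k₀) (hk₀r : k₀ + 1 ≤ r)
    (hm : m ≠ 0) (hr : (r : ℝ) ≤ 1 / 69 * ((m : ℝ) - (3 * k₀ + 3))) (hrm : 2 * r + 6 ≤ m)
    (hkm : 3 * k₀ + 3 ≤ m)
    (htail : 1 + δ / 8 ≤ (1 + δ / 4) * ((1 - (1 / 2) ^ k₀) / (1 + (1 / 2) ^ k₀)))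
    (hE : (1 + δ / 4) * (binomLe m r : ℝ) * Real.log 2 ≤
      (1 - 2 * p) ^ 2 * 2 ^ m / 2 * (1 - 2 * κ)) :
    bscFailProb m r p ≤ Real.exp (-(κ ^ 2 * (1 - 2 * p) ^ 2 * 2 ^ m / 4)) +
      (k₀ + r) * (2 : ℝ) ^ (m * (r + 2) - δ / 8 * (binomLe m r / 2 ^ r) : ℝ) := by
  have hK : (0 : ℝ) ≤ binomLe m r := Nat.cast_nonneg _
  have hn : (0 : ℝ) < 2 ^ m := by positivity
  set ρ : ℕ → ℝ := fun k => (1 - 2 * (1 / 2) ^ k) / (1 + 2 * (1 / 2) ^ k) with hρdef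
  set ρ₀ : ℝ := (1 - (1 / 2) ^ k₀) / (1 + (1 / 2) ^ k₀) with hρ₀def
  set A : ℕ → Finset (BF m) × ℝ := fun k =>
    (weightClass m r ((1 - (1 / 2) ^ k) / 2) (ρ k), ρ k) with hA
  set B : ℕ → Finset (BF m) × ℝ := fun l =>
    (weightClass m r (1 / 2 ^ l) (1 / 2 ^ (l + 1)), 1 / 2 ^ (l + 1)) with hB
  set D : Finset (BF m) × ℝ := (weightClass m r 1 ρ₀, ρ₀) with hD
  set J : Finset (Finset (BF m) × ℝ) :=
    insert D ((Finset.Icc 2 k₀).image A ∪ (Finset.Icc 2 r).image B) with hJ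
  set T : ℝ := m * (r + 2) - δ / 8 * (binomLe m r / 2 ^ r) with hT
  have hhalf : ∀ k : ℕ, 2 ≤ k → (1 / 2 : ℝ) ^ k ≤ 1 / 4 := fun k hk => by
    calc (1 / 2 : ℝ) ^ k ≤ (1 / 2) ^ 2 :=
          pow_le_pow_of_le_one (by norm_num) (by norm_num) hk
      _ = 1 / 4 := by norm_num
  have hhalf0 : ∀ k : ℕ, (0 : ℝ) < (1 / 2) ^ k := fun k => by positivity
  have hρk : ∀ k, 2 ≤ k → 1 / 3 ≤ ρ k := fun k hk => by
    have := hhalf k hk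
    have := hhalf0 k
    rw [hρdef, le_div_iff₀ (by positivity)]
    linarith
  have hρ₀ : 0 ≤ ρ₀ := by
    have := hhalf k₀ hk₀
    have := hhalf0 k₀
    exact div_nonneg (by linarith) (by linarith)
  have hr2 : 1 / (2 : ℝ) ^ r ≤ 1 / 4 := by
    rw [← one_div_pow]; exact hhalf r (by omega)
  have hB0 : (0 : ℝ) ≤ m * (r + 2) := by positivity
  have hKr : (binomLe m r : ℝ) / 2 ^ r = binomLe m r * (1 / 2 ^ r) := by ring
  have hJmem : ∀ c ∈ J, c = D ∨ (∃ k, (2 ≤ k ∧ k ≤ k₀) ∧ A k = c) ∨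
      ∃ l, (2 ≤ l ∧ l ≤ r) ∧ B l = c := fun c hc => by
    simpa only [hJ, Finset.mem_insert, Finset.mem_union, Finset.mem_image, Finset.mem_Icc]
      using hc
  have hpos : ∀ c ∈ J, 0 ≤ c.2 := by
    intro c hc
    obtain rfl | ⟨k, hk, rfl⟩ | ⟨l, hl, rfl⟩ := hJmem c hc
    · exact hρ₀
    · linarith [hρk k hk.1]
    · simp only [hB]; positivity
  have hcard : J.card ≤ k₀ + r := by
    calc J.card ≤ ((Finset.Icc 2 k₀).image A ∪ (Finset.Icc 2 r).image B).card + 1 :=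
          Finset.card_insert_le _ _
      _ ≤ (Finset.Icc 2 k₀).card + (Finset.Icc 2 r).card + 1 := by
          gcongr
          exact (Finset.card_union_le _ _).trans
            (add_le_add Finset.card_image_le Finset.card_image_le)
      _ ≤ k₀ + r := by
          rw [Nat.card_Icc, Nat.card_Icc]; omega
  refine (bscFailProb_le hp0 hp hκ hκ1 J ?_ hpos ?_).trans ?_
  · intro f hf hf0
    have hN1 : ((nz f).card : ℝ) ≤ 2 ^ m := by exact_mod_cast card_nz_le f
    have hN2 : (2 : ℝ) ^ m ≤ 2 ^ r * (nz f).card := by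
      exact_mod_cast two_pow_le_card_nz hf hf0
    have hN0 : (0 : ℝ) < (nz f).card := pos_of_mul_pos_right (hn.trans_le hN2) (by positivity)
    set N : ℝ := ((nz f).card : ℝ)
    have hρmul : ∀ a : ℝ, 0 ≤ a → (1 - a) / 2 * 2 ^ m ≤ N →
        (1 - a) / (1 + a) * 2 ^ m ≤ (1 + (1 - a) / (1 + a)) * N := by
      intro a ha h
      have h1 : 1 + (1 - a) / (1 + a) = 2 / (1 + a) := by field_simp; ring
      rw [h1, div_mul_eq_mul_div, div_mul_eq_mul_div]
      exact div_le_div_of_nonneg_right (by linarith) (by linarith)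
    by_cases hlarge : (1 - (1 / 2) ^ k₀) / 2 * 2 ^ m ≤ N
    · refine ⟨D, Finset.mem_insert_self _ _, Finset.mem_filter.2 ⟨mem_lowW.2 ⟨hf, ?_⟩, ?_⟩⟩
      · rwa [one_mul]
      · exact hρmul _ (hhalf0 k₀).le hlarge
    rw [not_le] at hlarge
    by_cases hmid : 1 / 4 * 2 ^ m < N
    · have hex : ∃ k : ℕ, N ≤ (1 - (1 / 2) ^ k) / 2 * 2 ^ m := ⟨k₀, hlarge.le⟩
      set k := Nat.find hex with hk
      have hks : N ≤ (1 - (1 / 2) ^ k) / 2 * 2 ^ m := Nat.find_spec hex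
      have hkk₀ : k ≤ k₀ := Nat.find_min' hex hlarge.le
      have hk2 : 2 ≤ k := by
        by_contra! h
        interval_cases hkv : k
        · norm_num at hks; linarith
        · norm_num at hks; linarith
      have hkm : ¬ N ≤ (1 - (1 / 2) ^ (k - 1)) / 2 * 2 ^ m :=
        Nat.find_min hex (show k - 1 < k by omega)
      have hpow : (1 / 2 : ℝ) ^ (k - 1) = 2 * (1 / 2) ^ k := by
        obtain ⟨j, hj⟩ : ∃ j, k = j + 1 := ⟨k - 1, by omega⟩
        rw [hj, Nat.add_sub_cancel, pow_succ]; ring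
      rw [hpow, not_le] at hkm
      refine ⟨A k, ?_, Finset.mem_filter.2 ⟨mem_lowW.2 ⟨hf, hks⟩, ?_⟩⟩
      · exact Finset.mem_insert_of_mem (Finset.mem_union_left _
          (Finset.mem_image_of_mem _ (Finset.mem_Icc.2 ⟨hk2, hkk₀⟩)))
      · exact hρmul _ (by positivity) hkm.le
    · rw [not_lt] at hmid
      set P : ℕ → Prop := fun l => N ≤ 1 / 2 ^ l * 2 ^ m with hP
      have hP2 : P 2 := by simp only [hP]; norm_num; linarith
      set l := Nat.findGreatest P r with hl
      have hls : P l := Nat.findGreatest_spec (show 2 ≤ r by omega) hP2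
      have hl2 : 2 ≤ l := Nat.le_findGreatest (by omega) hP2
      have hlr : l ≤ r := Nat.findGreatest_le r
      refine ⟨B l, ?_, Finset.mem_filter.2 ⟨mem_lowW.2 ⟨hf, hls⟩, ?_⟩⟩
      · exact Finset.mem_insert_of_mem (Finset.mem_union_right _
          (Finset.mem_image_of_mem _ (Finset.mem_Icc.2 ⟨hl2, hlr⟩)))
      · have h1 : 1 / 2 ^ (l + 1) * 2 ^ m ≤ N := by
          obtain h | h := hlr.lt_or_eq
          · have := Nat.findGreatest_is_greatest (P := P) (show l < l + 1 by omega)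
              (by omega)
            simp only [hP, not_le] at this
            exact this.le
          · rw [one_div_mul_eq_div, div_le_iff₀ (by positivity), h, pow_succ]
            nlinarith
        refine h1.trans (le_mul_of_one_le_left hN0.le ?_)
        have : (0 : ℝ) ≤ 1 / 2 ^ (l + 1) := by positivity
        linarith
  · intro c hc f hf
    obtain rfl | ⟨k, hk, rfl⟩ | ⟨l, hl, rfl⟩ := hJmem c hc
    · exact (Finset.mem_filter.1 hf).2
    · exact (Finset.mem_filter.1 hf).2
    · exact (Finset.mem_filter.1 hf).2
  · gcongr
    have hterm : ∀ c ∈ J, (c.1.card : ℝ) *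
        Real.exp (-((1 - 2 * p) ^ 2 * 2 ^ m / 2 * (1 - 2 * κ) * c.2)) ≤ 2 ^ T := by
      intro c hc
      have hc0 := hpos c hc
      have hcast : ∀ b ρ' : ℝ, ((weightClass m r b ρ').card : ℝ) ≤ (lowW m r b).card :=
        fun b ρ' => by exact_mod_cast Finset.card_filter_le _ _
      obtain rfl | ⟨k, hk, rfl⟩ | ⟨l, hl, rfl⟩ := hJmem c hc
      · refine card_mul_exp_le hc0 hE (N := (binomLe m r : ℝ)) (le_trans ?_ card_RM_le) ?_
        · norm_cast
          refine Finset.card_le_card fun f hf => ?_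
          exact Finset.mem_filter.2 ⟨Finset.mem_univ _,
            (mem_lowW.1 (Finset.mem_filter.1 hf).1).1⟩
        · have h1 := mul_le_mul_of_nonneg_left htail hK
          have h2 := mul_le_mul_of_nonneg_left hr2 (mul_nonneg hδ.le hK)
          have h3 := mul_nonneg hδ.le hK
          simp only [hT, hD, hKr]
          nlinarith
      · have hkr : (k : ℝ) ≤ k₀ := by exact_mod_cast hk.2
        refine card_mul_exp_le hc0 hE ((hcast _ _).trans (card_lowW_bias_le hm k hk.1
          (by omega) (hr.trans ?_) (by omega) (by omega))) ?_
        · linarith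
        · have h1 := mul_le_mul_of_nonneg_left (hρk k hk.1) (mul_nonneg hδ.le hK)
          have h2 := mul_le_mul_of_nonneg_left hr2 (mul_nonneg hδ.le hK)
          have h3 := mul_nonneg hδ.le hK
          change ρ k * _ + _ - _ * ρ k ≤ T
          simp only [hT, hKr]
          nlinarith
      · refine card_mul_exp_le hc0 hE ((hcast _ _).trans (card_lowW_le_half_weight hm
          (hr.trans ?_) hrm l hl.1 hl.2)) ?_
        · have : (0 : ℝ) ≤ k₀ := Nat.cast_nonneg _
          linarith
        · have h1 : 1 / (2 : ℝ) ^ r ≤ 2 * (1 / 2 ^ (l + 1)) := by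
            rw [pow_succ, ← one_div_mul_one_div, mul_comm, mul_assoc]
            norm_num
            exact inv_anti₀ (by positivity) (pow_le_pow_right₀ one_le_two hl.2)
          have h2 := mul_le_mul_of_nonneg_left h1 (mul_nonneg hδ.le hK)
          simp only [hT, hB, hKr]
          nlinarith
    calc _ ≤ J.card • (2 : ℝ) ^ T := Finset.sum_le_card_nsmul _ _ _ hterm
      _ ≤ _ := by
        rw [nsmul_eq_mul]
        gcongr
        exact_mod_cast hcard

end

/-! ### Asymptotics -/

open Filter in
lemma eventually_ceil_le {γ : ℝ} (hγ0 : 0 < γ) (hγ : γ ≤ 1 / 70) (C : ℝ) :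
    ∀ᶠ m : ℕ in atTop, (⌈γ * m⌉₊ : ℝ) ≤ 1 / 69 * ((m : ℝ) - C) := by
  filter_upwards [tendsto_natCast_atTop_atTop.eventually_ge_atTop (4830 * (1 + C / 69))]
    with m hm
  have h1 := (Nat.ceil_lt_add_one (show 0 ≤ γ * m by positivity)).le
  have h2 : γ * m ≤ 1 / 70 * m := by gcongr
  linarith

lemma pow_le_binomLe {m r : ℕ} (hr : (r : ℝ) ≤ 1 / 69 * m) : (69 : ℝ) ^ r ≤ binomLe m r := by
  have hrm : (r : ℝ) ≤ m := hr.trans (by have : (0 : ℝ) ≤ m := Nat.cast_nonneg _; linarith)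
  have h := binomLe_sub_le (θ := 1 / 69) (by norm_num) (by norm_num) r m r le_rfl
    (by exact_mod_cast hrm) hr
  have h1 : binomLe (m - r) (r - r) = 1 := by simp [binomLe]
  rw [h1, one_div_pow, one_div_mul_eq_div, le_div_iff₀ (by positivity)] at h
  simpa using h

open Filter in
lemma eventually_rate_lt {γ : ℝ} (hγ0 : 0 < γ) (hγ : γ ≤ 1 / 70) {ε : ℝ} (hε : 0 < ε) :
    ∀ᶠ m : ℕ in atTop, (binomLe m ⌈γ * m⌉₊ : ℝ) / 2 ^ m < ε := by
  obtain ⟨t, ht⟩ := exists_pow_lt_of_lt_one hε (show (69 / 136 : ℝ) < 1 by norm_num)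
  filter_upwards [eventually_ceil_le hγ0 hγ t, eventually_ge_atTop t] with m hm htm
  have h := le_binomLe_sub (θ := 1 / 69) (by norm_num) (by norm_num) _ t m htm hm
  have h2 : (binomLe (m - t) ⌈γ * m⌉₊ : ℝ) ≤ 2 ^ (m - t) := by
    exact_mod_cast binomLe_le_two_pow _ _
  refine lt_of_le_of_lt ?_ ht
  rw [div_le_iff₀ (by positivity)]
  have h3 : (2 : ℝ) ^ m = 2 ^ (m - t) * 2 ^ t := by rw [← pow_add]; congr 1; omega
  have h4 : (binomLe m ⌈γ * m⌉₊ : ℝ) = (69 / 68) ^ t * ((1 - 1 / 69) ^ t *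
      binomLe m ⌈γ * m⌉₊) := by
    rw [← mul_assoc, ← mul_pow]; norm_num
  rw [h4]
  calc (69 / 68 : ℝ) ^ t * ((1 - 1 / 69) ^ t * binomLe m ⌈γ * m⌉₊)
      ≤ (69 / 68) ^ t * 2 ^ (m - t) := by gcongr; exact h.trans h2
    _ = (69 / 136) ^ t * 2 ^ m := by
        rw [h3, show (69 / 68 : ℝ) = 69 / 136 * 2 by norm_num, mul_pow]; ring

open Filter in
lemma exists_bias_parameter {δ : ℝ} (hδ : 0 < δ) : ∃ k : ℕ, 2 ≤ k ∧
    1 + δ / 8 ≤ (1 + δ / 4) * ((1 - (1 / 2) ^ k) / (1 + (1 / 2) ^ k)) := by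
  have h0 : Tendsto (fun k : ℕ => (1 / 2 : ℝ) ^ k) atTop (nhds 0) :=
    tendsto_pow_atTop_nhds_zero_of_lt_one (by norm_num) (by norm_num)
  have h1 : Tendsto (fun k : ℕ => (1 + δ / 4) * ((1 - (1 / 2 : ℝ) ^ k) / (1 + (1 / 2) ^ k)))
      atTop (nhds ((1 + δ / 4) * ((1 - 0) / (1 + 0)))) :=
    ((h0.const_sub 1).div (h0.const_add 1) (by norm_num)).const_mul _
  obtain ⟨k, hk, hk2⟩ := ((h1.eventually (lt_mem_nhds (a := 1 + δ / 8)
    (by norm_num; linarith))).and (eventually_ge_atTop 2)).exists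
  exact ⟨k, hk2, hk.le⟩

open Filter in
lemma eventually_sq_le_exp {γ c : ℝ} (hγ0 : 0 < γ) (hc : 0 < c) :
    ∀ᶠ m : ℕ in atTop, (m : ℝ) ^ 2 ≤ c * 32 ^ ⌈γ * m⌉₊ := by
  have h1 : 1 < (32 : ℝ) ^ γ := Real.one_lt_rpow (by norm_num) hγ0
  filter_upwards [(tendsto_pow_const_div_const_pow_of_one_lt 2 h1).eventually
    (gt_mem_nhds hc)] with m hm
  rw [div_lt_iff₀ (by positivity)] at hm
  refine hm.le.trans ?_
  gcongr
  rw [← Real.rpow_natCast, ← Real.rpow_mul (by norm_num), ← Real.rpow_natCast]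
  exact Real.rpow_le_rpow_of_exponent_le (by norm_num) (Nat.le_ceil _)

lemma bscFailProb_nonneg {m r : ℕ} {p : ℝ} (hp0 : 0 ≤ p) (hp : p ≤ 1) :
    0 ≤ bscFailProb m r p := by
  refine Finset.sum_nonneg fun v _ => ?_
  have : 0 ≤ 1 - p := by linarith
  split_ifs <;> positivity

open Filter in
lemma eventually_bscFailProb_le {γ δ : ℝ} (hγ0 : 0 < γ) (hγ : γ ≤ 1 / 70) (hδ : 0 < δ)
    {p : ℕ → ℝ} (hp : ∀ᶠ m : ℕ in atTop, p m ∈ Set.Ioo (0 : ℝ) (1 / 2) ∧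
      binH (p m) = 1 - (1 + δ) * ((binomLe m ⌈γ * m⌉₊ : ℝ) / 2 ^ m)) :
    ∃ c > 0, ∀ᶠ m : ℕ in atTop, bscFailProb m ⌈γ * m⌉₊ (p m) ≤
      Real.exp (-(c * m)) + 2 * (m * (1 / 2) ^ m) := by
  obtain ⟨k₀, hk₀, htail⟩ := exists_bias_parameter hδ
  obtain ⟨θ, hθ, hent⟩ := exists_one_sub_binH_le (show 0 < δ / (2 + δ) by positivity)
  have hl : 0 < Real.log 2 := Real.log_pos one_lt_two
  set κ : ℝ := δ / (8 + 4 * δ) with hκdef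
  have hκ0 : 0 < κ := by positivity
  have hκ1 : κ ≤ 1 := by rw [hκdef, div_le_one (by positivity)]; linarith
  have hκδ : (1 + δ / 2) * (1 - 2 * κ) = 1 + δ / 4 := by rw [hκdef]; field_simp; ring
  refine ⟨κ ^ 2 / 2 * Real.log 2 * γ, by positivity, ?_⟩
  filter_upwards [hp, eventually_ceil_le hγ0 hγ (3 * k₀ + 3),
    eventually_rate_lt hγ0 hγ (show 0 < θ / (1 + δ) by positivity),
    eventually_sq_le_exp hγ0 (show 0 < δ / 48 by positivity),
    eventually_ge_atTop (3 * k₀ + 12),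
    tendsto_natCast_atTop_atTop.eventually_ge_atTop ((k₀ + 1) / γ)]
    with m ⟨hpm, hH⟩ hr hrate hexp hm hmγ
  set r := ⌈γ * m⌉₊
  set K : ℝ := (binomLe m r : ℝ)
  set μ := 1 - 2 * p m
  have hmR : (3 * k₀ + 12 : ℝ) ≤ m := by exact_mod_cast hm
  have hk₀R : (0 : ℝ) ≤ k₀ := Nat.cast_nonneg _
  have hn : (0 : ℝ) < 2 ^ m := by positivity
  have hγr : γ * m ≤ r := Nat.le_ceil _
  have hk₀r : k₀ + 1 ≤ r := by
    rw [div_le_iff₀ hγ0] at hmγ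
    have : (k₀ + 1 : ℝ) ≤ r := by linarith
    exact_mod_cast this
  have hrm : 2 * r + 6 ≤ m := by
    have : (2 * r + 6 : ℝ) ≤ m := by linarith
    exact_mod_cast this
  have hr69 : (r : ℝ) ≤ 1 / 69 * m := by linarith
  have hK69 : (69 : ℝ) ^ r ≤ K := pow_le_binomLe hr69
  have hKr : (r : ℝ) ≤ K := by
    refine le_trans ?_ hK69
    have h1 : r < 69 ^ r := Nat.lt_pow_self (by norm_num)
    exact_mod_cast h1.le
  have hK0 : 0 ≤ K := Nat.cast_nonneg _
  have hμn : (1 + δ / 2) * K * Real.log 2 ≤ μ ^ 2 * 2 ^ m / 2 := by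
    have h1 := hent (p m) hpm (by
      rw [lt_div_iff₀ (by positivity)] at hrate
      rw [hH]; linarith)
    rw [hH, sub_sub_cancel] at h1
    have h2 := mul_le_mul_of_nonneg_right h1 hn.le
    have h3 : Real.log 2 * ((1 + δ) * (K / 2 ^ m)) * 2 ^ m = (1 + δ) * K * Real.log 2 := by
      field_simp
    rw [h3] at h2
    have h4 : (1 + δ) = (1 + δ / 2) * (1 + δ / (2 + δ)) := by field_simp; ring
    rw [h4] at h2
    refine le_of_mul_le_mul_left (a := 1 + δ / (2 + δ)) ?_ (by positivity)
    linarith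
  have hE : (1 + δ / 4) * K * Real.log 2 ≤ μ ^ 2 * 2 ^ m / 2 * (1 - 2 * κ) := by
    rw [← hκδ]
    have : 0 ≤ 1 - 2 * κ := by
      by_contra! h
      nlinarith
    have := mul_le_mul_of_nonneg_right hμn this
    linarith
  refine (bscFailProb_le_of_capacity hpm.1 hpm.2 hκ0.le hκ1 hδ hk₀ hk₀r (by omega) hr hrm
    (by omega) htail hE).trans (add_le_add ?_ ?_)
  · refine Real.exp_le_exp.2 (neg_le_neg ?_)
    have h1 : K * Real.log 2 ≤ μ ^ 2 * 2 ^ m / 2 := by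
      have := mul_nonneg (mul_nonneg hδ.le hK0) hl.le
      linarith
    have h2 : γ * m * Real.log 2 ≤ μ ^ 2 * 2 ^ m / 2 :=
      le_trans (by gcongr; exact hγr.trans hKr) h1
    have h3 := mul_le_mul_of_nonneg_left h2 (show 0 ≤ κ ^ 2 / 2 by positivity)
    linarith
  · have h32 : (32 : ℝ) ^ r ≤ K / 2 ^ r := by
      rw [le_div_iff₀ (by positivity), ← mul_pow]
      refine le_trans (by gcongr; norm_num) hK69
    have hrmR : (r : ℝ) ≤ m := by linarith
    have hexpo : (m * (r + 2) - δ / 8 * (K / 2 ^ r) : ℝ) ≤ -m := by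
      have h1 := mul_le_mul_of_nonneg_left h32 (show 0 ≤ δ / 8 by positivity)
      have h2 : (m * (r + 2) : ℝ) ≤ m * (m + 2) := by gcongr
      nlinarith
    calc (k₀ + r) * (2 : ℝ) ^ (m * (r + 2) - δ / 8 * (K / 2 ^ r) : ℝ)
        ≤ (m + m) * (2 : ℝ) ^ (-m : ℝ) := by
          gcongr
          · linarith
          · norm_num
      _ = 2 * (m * (1 / 2) ^ m) := by
          rw [Real.rpow_neg (by norm_num), Real.rpow_natCast, one_div, inv_pow]; ring

/-- RM codes of degree ⌈γm⌉, γ ≤ 1/70, achieve capacity for the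
binary symmetric channel (Theorem `main thm - capacity for bsc`): for any
sequence p_m ∈ (0,1/2) with h(p_m) = 1 - (1+δ)R_m (which exists for all large
enough m), the probability that some nonzero codeword f satisfies
|v + F_f| ≤ |v| tends to 0. -/
theorem rm_achieves_capacity_BSC (γ δ : ℝ) (hγ0 : 0 < γ) (hγ : γ ≤ 1 / 70)
    (hδ : 0 < δ) (p : ℕ → ℝ)
    (hp : ∀ᶠ m : ℕ in Filter.atTop,
      p m ∈ Set.Ioo (0 : ℝ) (1 / 2) ∧
        binH (p m) = 1 - (1 + δ) * ((binomLe m ⌈γ * m⌉₊ : ℝ) / 2 ^ m)) :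
    Filter.Tendsto (fun m : ℕ => bscFailProb m ⌈γ * m⌉₊ (p m))
      Filter.atTop (nhds 0) := by
  obtain ⟨c, hc, hle⟩ := eventually_bscFailProb_le hγ0 hγ hδ hp
  refine squeeze_zero' (hp.mono fun m hm => bscFailProb_nonneg hm.1.1.le ?_) hle ?_
  · linarith [hm.1.2]
  · have h1 : Filter.Tendsto (fun m : ℕ => Real.exp (-(c * m))) Filter.atTop (nhds 0) :=
      Real.tendsto_exp_neg_atTop_nhds_zero.comp
        (tendsto_natCast_atTop_atTop.const_mul_atTop hc)
    have h2 := (tendsto_self_mul_const_pow_of_lt_one (r := 1 / 2) (by norm_num)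
      (by norm_num)).const_mul (2 : ℝ)
    simpa using h1.add h2
end

section
/- Let f : F₂^m → F₂ be a function such that wt(f) ≤ 2^{-k} for an integer k ≥ 2, and let δ ∈ (0,1). Set t = ⌈17·log₂(1/δ)⌉. Then there exist tuples Y₁, ..., Y_t ∈ (F₂^m)^{k-1} such that Pr_{x ∈ F₂^m}[ f(x) ≠ Maj(Δ_{Y₁}f(x), ..., Δ_{Y_t}f(x)) ] ≤ δ. -/
open Finset

/-- Discrete derivative of f in direction y: Δ_y f(x) = f(x+y) + f(x). -/
def DD {m : ℕ} (y : Cube m) (f : BF m) : BF m := fun x => f (x + y) + f x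

/-- Iterated discrete derivative Δ_Y f = Δ_{y₁}Δ_{y₂}···Δ_{y_k} f for a tuple
Y = (y₁,…,y_k) of directions. -/
def DDs {m k : ℕ} (Y : Fin k → Cube m) (f : BF m) : BF m :=
  (List.ofFn Y).foldr DD f

/-- Majority of a finite family of F₂ values: 1 if at least half of the values
equal 1, and 0 otherwise. -/
def Maj {ι : Type*} [Fintype ι] (v : ι → ZMod 2) : ZMod 2 :=
  if Fintype.card ι ≤ 2 * (Finset.univ.filter fun i => v i = 1).card then 1 else 0

/-- The real indicator of `a = 1`. -/
noncomputable def oneIndicator (a : ZMod 2) : ℝ := if a = 1 then 1 else 0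

lemma oneIndicator_add (a b : ZMod 2) :
    oneIndicator (a + b) =
      oneIndicator a + oneIndicator b - 2 * (oneIndicator a * oneIndicator b) := by
  have h01 : ∀ c : ZMod 2, c = 0 ∨ c = 1 := by decide
  have h : (1 : ZMod 2) + 1 = 0 := by decide
  rcases h01 a with rfl | rfl <;> rcases h01 b with rfl | rfl <;>
    simp only [oneIndicator, h, add_zero, zero_add, zero_ne_one, if_true, if_false] <;> norm_num

lemma oneIndicator_nonneg (a : ZMod 2) : 0 ≤ oneIndicator a := by
  unfold oneIndicator; split_ifs <;> norm_num

lemma oneIndicator_add_eq_ite (a b : ZMod 2) :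
    oneIndicator (a + b) = if a ≠ b then 1 else 0 := by
  have h : a + b = 1 ↔ a ≠ b := by revert a b; decide
  simp only [oneIndicator, h]

lemma sum_oneIndicator {m : ℕ} (g : BF m) : ∑ x, oneIndicator (g x) = 2 ^ m * wt g := by
  unfold wt oneIndicator
  rw [Finset.sum_boole]
  field_simp

lemma sum_oneIndicator_translate {m : ℕ} (g : BF m) (x : Cube m) :
    ∑ y, oneIndicator (g (x + y)) = 2 ^ m * wt g := by
  rw [← sum_oneIndicator]
  exact Equiv.sum_comp (Equiv.addLeft x) fun z => oneIndicator (g z)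

lemma wt_nonneg {m : ℕ} (g : BF m) : 0 ≤ wt g := by unfold wt; positivity

lemma sum_const_cube {m : ℕ} (c : ℝ) : ∑ _y : Cube m, c = 2 ^ m * c := by
  simp [Fintype.card_pi, ZMod.card]

lemma wt_DD_le {m : ℕ} (g : BF m) (y : Cube m) : wt (DD y g) ≤ 2 * wt g := by
  have h2 : (0 : ℝ) < 2 ^ m := by positivity
  refine le_of_mul_le_mul_left ?_ h2
  have hsum : ∑ x, oneIndicator (g (x + y)) = 2 ^ m * wt g := by
    simp_rw [add_comm _ y]
    exact sum_oneIndicator_translate g y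
  calc 2 ^ m * wt (DD y g) = ∑ x, oneIndicator (g (x + y) + g x) :=
        (sum_oneIndicator (DD y g)).symm
    _ ≤ ∑ x, (oneIndicator (g (x + y)) + oneIndicator (g x)) := by
        refine Finset.sum_le_sum fun x _ => ?_
        rw [oneIndicator_add]
        nlinarith [mul_nonneg (oneIndicator_nonneg (g (x + y))) (oneIndicator_nonneg (g x))]
    _ = 2 ^ m * (2 * wt g) := by
        rw [Finset.sum_add_distrib, hsum, sum_oneIndicator]; ring

/-- The `ν`-mass of the points where `g` and `f` differ. -/
noncomputable def errorMass {m : ℕ} (ν : Cube m → ℝ) (f g : BF m) : ℝ :=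
  ∑ x, ν x * oneIndicator (g x + f x)

lemma sum_errorMass_DD {m : ℕ} (ν : Cube m → ℝ) (f g : BF m) :
    ∑ y, errorMass ν f (DD y g) =
      2 ^ m * ((∑ x, ν x) * wt g + (1 - 2 * wt g) * errorMass ν f g) := by
  unfold errorMass DD
  rw [Finset.sum_comm]
  have h : ∀ x, ∑ y, ν x * oneIndicator (g (x + y) + g x + f x) =
      2 ^ m * (ν x * wt g + (1 - 2 * wt g) * (ν x * oneIndicator (g x + f x))) := by
    intro x
    have hy : ∀ y, ν x * oneIndicator (g (x + y) + g x + f x) =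
        ν x * (1 - 2 * oneIndicator (g x + f x)) * oneIndicator (g (x + y)) +
          ν x * oneIndicator (g x + f x) := by
      intro y
      rw [add_assoc, oneIndicator_add]; ring
    simp_rw [hy]
    rw [Finset.sum_add_distrib, ← Finset.mul_sum, sum_oneIndicator_translate, sum_const_cube]
    ring
  simp_rw [h]
  rw [← Finset.mul_sum, Finset.sum_add_distrib, ← Finset.sum_mul, ← Finset.mul_sum]

lemma sum_wt_DD {m : ℕ} (g : BF m) :
    ∑ y, wt (DD y g) = 2 ^ m * (2 * wt g * (1 - wt g)) := by
  have h2 : (2 : ℝ) ^ m ≠ 0 := by positivity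
  refine mul_left_cancel₀ h2 ?_
  have hm : ∀ h : BF m, errorMass (fun _ => 1) 0 h = 2 ^ m * wt h := fun h => by
    simp [errorMass, sum_oneIndicator]
  have h := sum_errorMass_DD (fun _ => (1 : ℝ)) 0 g
  simp_rw [hm] at h
  rw [Finset.mul_sum, h, sum_const_cube]
  ring

/-- Averaging over directions: if the error of `g` is small compared to its weight, then suitable
`j` further derivatives bring the error to at most a third of the total mass. -/
lemma exists_derivatives_errorMass_le {m : ℕ} (ν : Cube m → ℝ) (hν : ∀ x, 0 ≤ ν x) (f : BF m)
    (j : ℕ) : ∀ g : BF m, wt g * 2 ^ (j + 1) ≤ 1 →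
      errorMass ν f g ≤ (∑ x, ν x) * (1 / 3 - (2 ^ (j + 1) - 2) / 3 * wt g) →
      ∃ L : List (Cube m), L.length = j ∧ errorMass ν f (L.foldr DD g) ≤ (∑ x, ν x) / 3 := by
  induction j with
  | zero =>
    intro g _ hg
    refine ⟨[], rfl, ?_⟩
    norm_num at hg
    simpa [div_eq_mul_inv] using hg
  | succ j ih =>
    intro g hw hg
    set N := ∑ x, ν x
    have hN : 0 ≤ N := Finset.sum_nonneg fun x _ => hν x
    have hw0 := wt_nonneg g
    obtain ⟨c, hc⟩ : ∃ c : ℝ, c = (2 ^ (j + 1) - 2) / 3 := ⟨_, rfl⟩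
    have hc' : ((2 : ℝ) ^ (j + 1 + 1) - 2) / 3 = 2 * c + 2 / 3 := by rw [hc]; ring
    have hcw : wt g * (3 * c + 2) ≤ 1 / 2 := by
      have : wt g * (3 * c + 2) * 2 = wt g * 2 ^ (j + 1 + 1) := by rw [hc]; ring
      linarith
    have hc0 : 0 ≤ c := by
      rw [hc, pow_succ]
      have : (1 : ℝ) ≤ 2 ^ j := one_le_pow₀ (by norm_num)
      linarith
    rw [hc'] at hg
    have hhalf : 0 ≤ 1 - 2 * wt g := by nlinarith
    have havg : N * wt g + (1 - 2 * wt g) * errorMass ν f g +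
        N * c * (2 * wt g * (1 - wt g)) ≤ N / 3 := by
      have h1 := mul_le_mul_of_nonneg_left hg hhalf
      have h2 : 0 ≤ N * (wt g * (1 / 2 - wt g * (3 * c + 2))) := by
        have : 0 ≤ 1 / 2 - wt g * (3 * c + 2) := by linarith
        positivity
      nlinarith
    obtain ⟨y, -, hy⟩ := Finset.exists_le_of_sum_le (s := (univ : Finset (Cube m)))
      (f := fun y => errorMass ν f (DD y g) + N * c * wt (DD y g)) (g := fun _ => N / 3)
      univ_nonempty (by
        rw [Finset.sum_add_distrib, ← Finset.mul_sum, sum_errorMass_DD, sum_wt_DD,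
          sum_const_cube]
        have h2 : (0 : ℝ) ≤ 2 ^ m := by positivity
        have := mul_le_mul_of_nonneg_left havg h2
        linarith)
    obtain ⟨L, hL, hLe⟩ := ih (DD y g)
      (by
        have h := mul_le_mul_of_nonneg_right (wt_DD_le g y)
          (by positivity : (0 : ℝ) ≤ 2 ^ (j + 1))
        calc _ ≤ _ := h
          _ = wt g * 2 ^ (j + 1 + 1) := by ring
          _ ≤ 1 := hw)
      (by rw [← hc]; linarith)
    exact ⟨L ++ [y], by simp [hL], by simpa using hLe⟩

lemma exists_DDs_errorMass_le {m k : ℕ} (hk : 1 ≤ k) (f : BF m)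
    (hf : wt f ≤ (2 : ℝ) ^ (-(k : ℤ))) (ν : Cube m → ℝ) (hν : ∀ x, 0 ≤ ν x) :
    ∃ Y : Fin (k - 1) → Cube m, errorMass ν f (DDs Y f) ≤ (∑ x, ν x) / 3 := by
  have hw : wt f * 2 ^ (k - 1 + 1) ≤ 1 := by
    rw [Nat.sub_add_cancel hk]
    calc wt f * 2 ^ k ≤ (2 : ℝ) ^ (-(k : ℤ)) * 2 ^ k := by gcongr
      _ = 1 := by rw [zpow_neg, zpow_natCast]; field_simp
  have hN : 0 ≤ ∑ x, ν x := Finset.sum_nonneg fun x _ => hν x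
  have hself : errorMass ν f f = 0 := by simp [errorMass, oneIndicator_add_eq_ite]
  obtain ⟨L, hL, hLe⟩ := exists_derivatives_errorMass_le ν hν f (k - 1) f hw (by
    rw [hself]
    refine mul_nonneg hN ?_
    nlinarith [wt_nonneg f])
  rw [← hL]
  exact ⟨L.get, by simpa [DDs] using hLe⟩

/-- Boosting with multiplicative weights: if every nonnegative weighting of the points admits a
member of `h` whose errors carry at most a third of the mass, then some `t` members have total
exponential loss at most `(4 / 3) ^ t` per unit of mass. -/
lemma exists_prod_loss_le {X ι : Type*} [Fintype X] (bad : ι → X → Prop)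
    [∀ i x, Decidable (bad i x)]
    (hweak : ∀ ν : X → ℝ, (∀ x, 0 ≤ ν x) →
      ∃ i, ∑ x, ν x * (if bad i x then 1 else 0) ≤ (∑ x, ν x) / 3) (t : ℕ) :
    ∃ Y : Fin t → ι, ∑ x, ∏ i, (if bad (Y i) x then (2 : ℝ) else 1) ≤
      (Fintype.card X : ℝ) * (4 / 3) ^ t := by
  induction t with
  | zero => exact ⟨Fin.elim0, by simp⟩
  | succ t ih =>
    obtain ⟨Y, hY⟩ := ih
    obtain ⟨i, hi⟩ := hweak (fun x => ∏ i, (if bad (Y i) x then (2 : ℝ) else 1))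
      fun x => Finset.prod_nonneg fun i _ => by split_ifs <;> norm_num
    refine ⟨Fin.cons i Y, ?_⟩
    simp only [Fin.prod_univ_succ, Fin.cons_zero, Fin.cons_succ]
    set ν : X → ℝ := fun x => ∏ i, (if bad (Y i) x then (2 : ℝ) else 1)
    calc ∑ x, (if bad i x then (2 : ℝ) else 1) * ν x
        = ∑ x, ν x + ∑ x, ν x * (if bad i x then 1 else 0) := by
          rw [← Finset.sum_add_distrib]
          refine Finset.sum_congr rfl fun x _ => ?_
          split_ifs <;> ring
      _ ≤ ∑ x, ν x * (4 / 3) := by rw [← Finset.sum_mul]; linarith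
      _ ≤ (Fintype.card X : ℝ) * (4 / 3) ^ (t + 1) := by
          rw [← Finset.sum_mul, pow_succ, ← mul_assoc]
          gcongr

lemma card_le_two_mul_of_ne_Maj {ι : Type*} [Fintype ι] (v : ι → ZMod 2) (a : ZMod 2)
    (h : a ≠ Maj v) : Fintype.card ι ≤ 2 * (univ.filter fun i => v i ≠ a).card := by
  have h01 : ∀ b : ZMod 2, b = 0 ∨ b = 1 := by decide
  have hone : ∀ b : ZMod 2, b ≠ 0 ↔ b = 1 := by decide
  have hcard := Finset.card_filter_add_card_filter_not (s := (univ : Finset ι)) fun i => v i = 1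
  rw [Finset.card_univ] at hcard
  unfold Maj at h
  rcases h01 a with rfl | rfl
  · simp only [hone]
    by_contra hlt
    simp [hlt] at h
  · by_cases hle : Fintype.card ι ≤ 2 * (univ.filter fun i => v i = 1).card
    · simp [hle] at h
    · simp only [ne_eq]
      omega

lemma eight_ninths_pow_ceil_le {δ : ℝ} (hδ0 : 0 < δ) :
    (8 / 9 : ℝ) ^ ⌈17 * Real.logb 2 (1 / δ)⌉₊ ≤ δ ^ 2 := by
  set t := ⌈17 * Real.logb 2 (1 / δ)⌉₊
  have ht : 17 * Real.logb 2 (1 / δ) ≤ t := Nat.le_ceil _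
  have hlog2 : 0 < Real.log 2 := Real.log_pos (by norm_num)
  rw [Real.logb, one_div, Real.log_inv] at ht
  have ht' : -(17 * Real.log δ) ≤ t * Real.log 2 := by
    have := mul_le_mul_of_nonneg_right ht hlog2.le
    field_simp at this
    linarith
  have h89 : 17 * Real.log (8 / 9) ≤ -(2 * Real.log 2) := by
    have h : Real.log ((8 / 9 : ℝ) ^ 17) ≤ Real.log ((2 ^ 2 : ℝ)⁻¹) :=
      Real.log_le_log (by norm_num) (by norm_num)
    rw [Real.log_inv, Real.log_pow, Real.log_pow] at h
    exact_mod_cast h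
  rw [← Real.log_le_log_iff (by positivity) (by positivity), Real.log_pow, Real.log_pow]
  have := mul_le_mul_of_nonneg_left h89 (Nat.cast_nonneg t : (0 : ℝ) ≤ t)
  push_cast
  nlinarith

/-- a function of weight at most 2^{-k} is δ-approximated by the
majority of t = ⌈17 log₂(1/δ)⌉ of its order-(k-1) derivatives
(Lemma 2.2 of Kaufman–Lovett–Porat, `KPL1`). -/
theorem low_weight_approx_by_derivatives (m k : ℕ) (hk : 2 ≤ k) (f : BF m)
    (hf : wt f ≤ (2 : ℝ) ^ (-(k : ℤ))) (δ : ℝ) (hδ0 : 0 < δ) (hδ1 : δ < 1) :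
    ∃ Y : Fin ⌈17 * Real.logb 2 (1 / δ)⌉₊ → Fin (k - 1) → Cube m,
      (((Finset.univ.filter fun x : Cube m =>
            f x ≠ Maj fun i => DDs (Y i) f x).card : ℝ) / 2 ^ m) ≤ δ := by
  set t := ⌈17 * Real.logb 2 (1 / δ)⌉₊
  obtain ⟨Y, hY⟩ := exists_prod_loss_le (fun Y x => DDs Y f x ≠ f x)
    (fun ν hν => by
      obtain ⟨Y, hY⟩ := exists_DDs_errorMass_le (by omega : 1 ≤ k) f hf ν hν
      exact ⟨Y, by simpa only [errorMass, oneIndicator_add_eq_ite] using hY⟩) t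
  refine ⟨Y, ?_⟩
  set B := univ.filter fun x : Cube m => f x ≠ Maj fun i => DDs (Y i) f x
  have hB : (B.card : ℝ) * √2 ^ t ≤ 2 ^ m * (4 / 3) ^ t := by
    have hcard : (Fintype.card (Cube m) : ℝ) = 2 ^ m := by simp [ZMod.card]
    rw [hcard] at hY
    refine le_trans ?_ hY
    rw [← nsmul_eq_mul]
    refine (Finset.card_nsmul_le_sum B _ _ fun x hx => ?_).trans
      (Finset.sum_le_univ_sum_of_nonneg fun x => Finset.prod_nonneg fun i _ => by
        split_ifs <;> norm_num)
    have hmaj := card_le_two_mul_of_ne_Maj _ _ (Finset.mem_filter.mp hx).2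
    rw [Fintype.card_fin] at hmaj
    rw [Finset.prod_ite, Finset.prod_const, Finset.prod_const_one, mul_one]
    calc √2 ^ t ≤ √2 ^ (2 * (univ.filter fun i => DDs (Y i) f x ≠ f x).card) :=
          pow_le_pow_right₀ (by simp) hmaj
      _ = _ := by rw [pow_mul, Real.sq_sqrt (by norm_num)]
  have hfrac : (B.card : ℝ) / 2 ^ m ≤ (4 / 3 / √2) ^ t := by
    rw [div_pow, div_le_div_iff₀ (by positivity) (by positivity)]
    linarith
  refine hfrac.trans (abs_le_of_sq_le_sq' ?_ hδ0.le).2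
  calc ((4 / 3 / √2 : ℝ) ^ t) ^ 2 = (8 / 9) ^ t := by
        rw [← pow_mul, mul_comm, pow_mul, div_pow, Real.sq_sqrt (by norm_num)]
        norm_num
    _ ≤ δ ^ 2 := eight_ninths_pow_ceil_le hδ0
end
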